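/- Let n ≥ 4 and let σ and τ be two distinct basic involutions in the Weyl group W of type D_n. Then their Kostant–Kumar polynomials differ: d_σ ≠ d_τ in ℂ(x_1,…,x_n) (for any choices of reduced decompositions of σ and τ). -/

import Mathlib

/-!
The Weyl group of type `Dₙ`, realized as the group of permutations `w` of `ℤ`
supported on `{±1, …, ±n}` with `w (-i) = - w i` and an even number of sign changes.
-/

open Equiv

/-- The simple reflections of type `Dₙ`, indexed by `i ∈ {1, …, n}`:
`sᵢ = (i, i+1)(-i, -(i+1))` for `1 ≤ i ≤ n - 1`, and
`sₙ = (n-1, -n)(-(n-1), n)`. -/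
def simpleRefl (n : ℕ) (i : ℕ) : Equiv.Perm ℤ :=
  if i < n then Equiv.swap (i : ℤ) ((i : ℤ) + 1) * Equiv.swap (-(i : ℤ)) (-((i : ℤ) + 1))
  else Equiv.swap ((n : ℤ) - 1) (-(n : ℤ)) * Equiv.swap (-((n : ℤ) - 1)) (n : ℤ)

/-- A word in the letters `{1, …, n}` (indices of simple reflections). -/
def IsWord (n : ℕ) (L : List ℕ) : Prop := ∀ i ∈ L, 1 ≤ i ∧ i ≤ n

/-- The product `s_{i₁} ⋯ s_{i_l}` of the word `L = [i₁, …, i_l]`. -/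
def wordProd (n : ℕ) (L : List ℕ) : Equiv.Perm ℤ := (L.map (simpleRefl n)).prod

/-- Membership in the Weyl group `W` of type `Dₙ`: a permutation of `ℤ` commuting with
negation, fixing every integer of absolute value `> n`, and with an even number of
`i ∈ {1, …, n}` such that `w i < 0`. -/
def IsD (n : ℕ) (w : Equiv.Perm ℤ) : Prop :=
  (∀ i : ℤ, w (-i) = -(w i)) ∧ (∀ i : ℤ, (n : ℤ) < |i| → w i = i) ∧
    Even (((Finset.Icc (1 : ℤ) (n : ℤ)).filter fun i => w i < 0).card)

/-- The length `ℓ(w)`: the minimal number of factors in an expression of `w` as a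
product of simple reflections. -/
noncomputable def weylLength (n : ℕ) (w : Equiv.Perm ℤ) : ℕ :=
  sInf {l | ∃ L : List ℕ, IsWord n L ∧ L.length = l ∧ wordProd n L = w}

/-- `L` is a reduced decomposition of `w`. -/
def IsReducedWord (n : ℕ) (w : Equiv.Perm ℤ) (L : List ℕ) : Prop :=
  IsWord n L ∧ wordProd n L = w ∧ L.length = weylLength n w

/-- `w` is a basic involution: `w ∈ W`, `w² = id`, and `w i ≠ -i` for all `i ∈ {1, …, n}`. -/
def IsBasicInvolution (n : ℕ) (w : Equiv.Perm ℤ) : Prop :=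
  IsD n w ∧ w * w = 1 ∧ ∀ i : ℤ, 1 ≤ i → i ≤ (n : ℤ) → w i ≠ -i
open MvPolynomial

/-- The field `ℂ(x₁, …, xₙ)` of rational functions. -/
abbrev KK (n : ℕ) : Type := FractionRing (MvPolynomial (Fin n) ℂ)

/-- The linear polynomial `ε_k` for `k ∈ {±1, …, ±n}`: `ε_k = x_k` for `1 ≤ k ≤ n`
and `ε_{-k} = -ε_k` (and `0` for `k` out of range). -/
noncomputable def epsPoly (n : ℕ) (k : ℤ) : MvPolynomial (Fin n) ℂ :=
  if h : 1 ≤ k ∧ k ≤ (n : ℤ) then X (⟨(k - 1).toNat, by omega⟩ : Fin n)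
  else if h' : 1 ≤ -k ∧ -k ≤ (n : ℤ) then -X (⟨(-k - 1).toNat, by omega⟩ : Fin n)
  else 0

/-- The simple roots: `αᵢ = xᵢ - xᵢ₊₁` for `1 ≤ i ≤ n - 1` and `αₙ = xₙ₋₁ + xₙ`. -/
noncomputable def simpleRootPoly (n : ℕ) (i : ℕ) : MvPolynomial (Fin n) ℂ :=
  if i < n then epsPoly n (i : ℤ) - epsPoly n ((i : ℤ) + 1)
  else epsPoly n ((n : ℤ) - 1) + epsPoly n (n : ℤ)

/-- The action of a signed permutation `w` on polynomials, sending `xᵢ = ε_i` to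
`ε_{w(i)}` (with `1`-based indexing of the variables). -/
noncomputable def polyAct (n : ℕ) (w : Equiv.Perm ℤ) :
    MvPolynomial (Fin n) ℂ →ₐ[ℂ] MvPolynomial (Fin n) ℂ :=
  aeval fun i : Fin n => epsPoly n (w (((i : ℕ) : ℤ) + 1))

/-- The partial product `s_{i₁}^{ε₁} ⋯ s_{i_k}^{ε_k}` of a word `L` with
exponent pattern `E`. -/
def maskedPrefix (n : ℕ) (L : List ℕ) (E : ℕ → Bool) (k : ℕ) : Equiv.Perm ℤ :=
  ((List.range k).map fun m => if E m then simpleRefl n (L.getD m 0) else 1).prod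

/-- The element `c_{w,v}` computed from a word `L = [i₁, …, i_l]` for `w`:
`c_{w,v} = (-1)^l ∑ ∏_{k=1}^{l} (s_{i₁}^{ε₁} ⋯ s_{i_k}^{ε_k}(α_{i_k}))⁻¹`,
the sum over all `(ε₁, …, ε_l) ∈ {0,1}^l` with `s_{i₁}^{ε₁} ⋯ s_{i_l}^{ε_l} = v`. -/
noncomputable def cElem (n : ℕ) (L : List ℕ) (v : Equiv.Perm ℤ) : KK n := by
  classical
  exact (-1 : KK n) ^ L.length *
    ∑ E : Fin L.length → Bool,
      if maskedPrefix n L (fun m => if h : m < L.length then E ⟨m, h⟩ else false) L.length = v then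
        ∏ k ∈ Finset.range L.length,
          (algebraMap (MvPolynomial (Fin n) ℂ) (KK n)
            (polyAct n
              (maskedPrefix n L (fun m => if h : m < L.length then E ⟨m, h⟩ else false) (k + 1))
              (simpleRootPoly n (L.getD k 0))))⁻¹
      else 0

/-- The product `∏_{α ∈ Φ⁺} α` of all positive roots of `Dₙ`. -/
noncomputable def prodPosRoots (n : ℕ) : MvPolynomial (Fin n) ℂ :=
  ∏ p ∈ Finset.univ.filter (fun p : Fin n × Fin n => p.1 < p.2),
    ((X p.1 - X p.2) * (X p.1 + X p.2))

/-- The Kostant–Kumar polynomial `d_w = (-1)^{ℓ(w)} ⬝ c_w ⬝ ∏_{α ∈ Φ⁺} α`, computed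
from a word `L` for `w` (here `c_w = c_{w, id}`). -/
noncomputable def dElem (n : ℕ) (L : List ℕ) : KK n :=
  (-1 : KK n) ^ L.length * cElem n L 1 *
    algebraMap (MvPolynomial (Fin n) ℂ) (KK n) (prodPosRoots n)

/-- The first column `𝒞₁ = {ε₁ - ε_j, ε₁ + ε_j : 2 ≤ j ≤ n}` of `Φ⁺`, as a set of
linear polynomials (`ε_j` is the variable `X (j-1)`). -/
def col1Set (n : ℕ) : Set (MvPolynomial (Fin n) ℂ) :=
  {p | ∃ i j : Fin n, (i : ℕ) = 0 ∧ 0 < (j : ℕ) ∧ (p = X i - X j ∨ p = X i + X j)}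

/-- The support of an involution `w`, as a set of linear polynomials: it contains
`ε_i - ε_j` whenever `1 ≤ i < j ≤ n` and `w(i) = j`, and `ε_i + ε_j` whenever
`1 ≤ i < j ≤ n` and `w(i) = -j`. -/
def suppPoly (n : ℕ) (w : Equiv.Perm ℤ) : Set (MvPolynomial (Fin n) ℂ) :=
  {p | ∃ i j : Fin n, i < j ∧
    ((w (((i : ℕ) : ℤ) + 1) = ((j : ℕ) : ℤ) + 1 ∧ p = X i - X j) ∨
     (w (((i : ℕ) : ℤ) + 1) = -(((j : ℕ) : ℤ) + 1) ∧ p = X i + X j))}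

/-- The reflection exchanging `a` with `b` and `-a` with `-b`. -/
def signedSwap (a b : ℤ) : Equiv.Perm ℤ := Equiv.swap a b * Equiv.swap (-a) (-b)

/-- The larger letter of the simple root `αᵢ = ε_p - ε_q`. -/
def fstLetter (n i : ℕ) : ℤ := if i < n then (i : ℤ) else (n : ℤ) - 1

/-- The smaller letter of the simple root `αᵢ = ε_p - ε_q`. -/
def sndLetter (n i : ℕ) : ℤ := if i < n then (i : ℤ) + 1 else -(n : ℤ)

/-- The height of a letter: `ε_a - ε_b` is a positive root when `a` is higher than `b`. -/
def letterHeight (n : ℕ) (a : ℤ) : ℤ := if 0 < a then (n : ℤ) - a else -(n : ℤ) - a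

/-- The letters `±1, …, ±n`. -/
def IsLetter (n : ℕ) (a : ℤ) : Prop := a ≠ 0 ∧ -(n : ℤ) ≤ a ∧ a ≤ n

/-- `ε_a - ε_b` is a root. -/
def IsRootPair (n : ℕ) (a b : ℤ) : Prop := IsLetter n a ∧ IsLetter n b ∧ a ≠ b ∧ a ≠ -b

/-- Signed permutations of `±1, …, ±n`. -/
structure IsSigned (n : ℕ) (w : Equiv.Perm ℤ) : Prop where
  odd : ∀ a, w (-a) = -w a
  fix : ∀ a, (n : ℤ) < |a| → w a = a

theorem simpleRefl_eq_signedSwap (n i : ℕ) :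
    simpleRefl n i = signedSwap (fstLetter n i) (sndLetter n i) := by
  unfold simpleRefl signedSwap fstLetter sndLetter
  split_ifs <;> simp

theorem signedSwap_apply {a b : ℤ} (ha : a ≠ 0) (hb : b ≠ 0) (hab : a ≠ b) (hab' : a ≠ -b) (x : ℤ) :
    signedSwap a b x =
      if x = a then b else if x = b then a else if x = -a then -b else if x = -b then -a else x := by
  simp only [signedSwap, Equiv.Perm.mul_apply, Equiv.swap_apply_def]
  split_ifs <;> omega

theorem signedSwap_comm (a b : ℤ) : signedSwap a b = signedSwap b a := by
  simp [signedSwap, Equiv.swap_comm]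

theorem signedSwap_neg (a b : ℤ) : a ≠ 0 → b ≠ 0 → a ≠ b → a ≠ -b →
    signedSwap (-b) (-a) = signedSwap a b := by
  intro ha hb hab hab'
  ext x
  rw [signedSwap_apply ha hb hab hab', signedSwap_apply (by omega) (by omega) (by omega) (by omega)]
  split_ifs <;> omega

namespace IsSigned

variable {n : ℕ} {w v : Equiv.Perm ℤ}

theorem one : IsSigned n 1 := ⟨fun _ => rfl, fun _ _ => rfl⟩

theorem mul (hw : IsSigned n w) (hv : IsSigned n v) : IsSigned n (w * v) :=
  ⟨fun a => by simp [hv.odd, hw.odd], fun a ha => by simp [hv.fix a ha, hw.fix a ha]⟩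

theorem inv (hw : IsSigned n w) : IsSigned n w⁻¹ :=
  ⟨fun a => by
    rw [Equiv.Perm.inv_eq_iff_eq, hw.odd, ← Equiv.Perm.mul_apply, mul_inv_cancel,
      Equiv.Perm.one_apply], fun a ha => by
    rw [Equiv.Perm.inv_eq_iff_eq, hw.fix a ha]⟩

theorem map_zero (hw : IsSigned n w) : w 0 = 0 := by
  have := hw.odd 0
  simp at this
  omega

theorem isLetter (hw : IsSigned n w) {a : ℤ} (ha : IsLetter n a) : IsLetter n (w a) := by
  have h0 : w a ≠ 0 := fun h => ha.1 (w.injective (h.trans hw.map_zero.symm))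
  have h1 : ¬ (n : ℤ) < |w a| := fun h => by
    have := w.injective (hw.fix _ h)
    rw [this] at h
    have := ha.2
    rw [lt_abs] at h
    omega
  rw [lt_abs] at h1
  exact ⟨h0, by omega, by omega⟩

theorem isRootPair (hw : IsSigned n w) {a b : ℤ} (h : IsRootPair n a b) :
    IsRootPair n (w a) (w b) :=
  ⟨hw.isLetter h.1, hw.isLetter h.2.1, fun e => h.2.2.1 (w.injective e), fun e =>
    h.2.2.2 (w.injective (by rw [hw.odd]; exact e))⟩

theorem signedSwap {a b : ℤ} (h : IsRootPair n a b) : IsSigned n (signedSwap a b) := by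
  obtain ⟨⟨ha, ha'⟩, ⟨hb, hb'⟩, hab, hab'⟩ := h
  constructor
  · intro x
    simp only [signedSwap_apply ha hb hab hab']
    split_ifs <;> omega
  · intro x hx
    rw [lt_abs] at hx
    rw [signedSwap_apply ha hb hab hab']
    split_ifs <;> omega

theorem mul_signedSwap (hw : IsSigned n w) (a b : ℤ) :
    w * _root_.signedSwap a b = _root_.signedSwap (w a) (w b) * w := by
  unfold _root_.signedSwap
  rw [← mul_assoc, Equiv.mul_swap_eq_swap_mul w, mul_assoc, Equiv.mul_swap_eq_swap_mul w, hw.odd,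
    hw.odd, mul_assoc]

end IsSigned

section Simple

variable {n i j : ℕ}

theorem letters_spec (hn : 2 ≤ n) (hi : 1 ≤ i ∧ i ≤ n) :
    1 ≤ fstLetter n i ∧ fstLetter n i < n ∧
      (sndLetter n i = fstLetter n i + 1 ∨ (fstLetter n i = n - 1 ∧ sndLetter n i = -n)) := by
  unfold fstLetter sndLetter
  split_ifs <;> omega

theorem isRootPair_letters (hn : 2 ≤ n) (hi : 1 ≤ i ∧ i ≤ n) :
    IsRootPair n (fstLetter n i) (sndLetter n i) := by
  have := letters_spec hn hi
  unfold IsRootPair IsLetter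
  omega

theorem simpleRefl_apply (hn : 2 ≤ n) (hi : 1 ≤ i ∧ i ≤ n) (x : ℤ) :
    simpleRefl n i x =
      if x = fstLetter n i then sndLetter n i else if x = sndLetter n i then fstLetter n i else
      if x = -fstLetter n i then -sndLetter n i else if x = -sndLetter n i then -fstLetter n i
      else x := by
  obtain ⟨⟨ha, -⟩, ⟨hb, -⟩, hab, hab'⟩ := isRootPair_letters hn hi
  rw [simpleRefl_eq_signedSwap, signedSwap_apply ha hb hab hab']

theorem simpleRefl_cases (hn : 2 ≤ n) (hi : 1 ≤ i ∧ i ≤ n) (x : ℤ) :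
    (x = fstLetter n i ∧ simpleRefl n i x = sndLetter n i) ∨
    (x = sndLetter n i ∧ simpleRefl n i x = fstLetter n i) ∨
    (x = -fstLetter n i ∧ simpleRefl n i x = -sndLetter n i) ∨
    (x = -sndLetter n i ∧ simpleRefl n i x = -fstLetter n i) ∨
    (x ≠ fstLetter n i ∧ x ≠ sndLetter n i ∧ x ≠ -fstLetter n i ∧ x ≠ -sndLetter n i ∧
      simpleRefl n i x = x) := by
  rw [simpleRefl_apply hn hi]
  split_ifs <;> tauto

theorem letterHeight_cases (n : ℕ) (a : ℤ) :
    (0 < a ∧ letterHeight n a = n - a) ∨ (a ≤ 0 ∧ letterHeight n a = -n - a) := by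
  unfold letterHeight
  split_ifs <;> omega

theorem isSigned_simpleRefl (hn : 2 ≤ n) (hi : 1 ≤ i ∧ i ≤ n) : IsSigned n (simpleRefl n i) := by
  rw [simpleRefl_eq_signedSwap]
  exact .signedSwap (isRootPair_letters hn hi)

theorem simpleRefl_simpleRefl_apply (hn : 2 ≤ n) (hi : 1 ≤ i ∧ i ≤ n) (x : ℤ) :
    simpleRefl n i (simpleRefl n i x) = x := by
  have h := isRootPair_letters hn hi
  unfold IsRootPair IsLetter at h
  simp only [simpleRefl_apply hn hi]
  split_ifs <;> omega

theorem simpleRefl_mul_self (hn : 2 ≤ n) (hi : 1 ≤ i ∧ i ≤ n) :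
    simpleRefl n i * simpleRefl n i = 1 :=
  Equiv.ext fun x => simpleRefl_simpleRefl_apply hn hi x

theorem simpleRefl_mul_cancel (hn : 2 ≤ n) (hi : 1 ≤ i ∧ i ≤ n) (w : Equiv.Perm ℤ) :
    simpleRefl n i * (simpleRefl n i * w) = w := by
  rw [← mul_assoc, simpleRefl_mul_self hn hi, one_mul]

theorem simpleRefl_inv (hn : 2 ≤ n) (hi : 1 ≤ i ∧ i ≤ n) :
    (simpleRefl n i)⁻¹ = simpleRefl n i :=
  inv_eq_of_mul_eq_one_left (simpleRefl_mul_self hn hi)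

/-- The only positive root made negative by a simple reflection is its simple root. -/
theorem eq_letters_of_height_lt (hn : 2 ≤ n) (hi : 1 ≤ i ∧ i ≤ n) {a b : ℤ}
    (hab : IsRootPair n a b) (h : letterHeight n b < letterHeight n a)
    (h' : letterHeight n (simpleRefl n i a) < letterHeight n (simpleRefl n i b)) :
    (a = fstLetter n i ∧ b = sndLetter n i) ∨ (a = -sndLetter n i ∧ b = -fstLetter n i) := by
  have hs := letters_spec hn hi
  unfold IsRootPair IsLetter at hab
  have ha := letterHeight_cases n a
  have hb := letterHeight_cases n b
  have ha' := letterHeight_cases n (simpleRefl n i a)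
  have hb' := letterHeight_cases n (simpleRefl n i b)
  rcases simpleRefl_cases hn hi a with h1 | h1 | h1 | h1 | h1 <;>
  rcases simpleRefl_cases hn hi b with h2 | h2 | h2 | h2 | h2 <;> omega

theorem height_ne_of_isRootPair {a b : ℤ} (h : IsRootPair n a b) :
    letterHeight n a ≠ letterHeight n b := by
  unfold IsRootPair IsLetter at h
  have := letterHeight_cases n a
  have := letterHeight_cases n b
  omega

end Simple

section Words

variable {n : ℕ}

theorem wordProd_nil (n : ℕ) : wordProd n [] = 1 := rfl

theorem wordProd_cons (n i : ℕ) (L : List ℕ) :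
    wordProd n (i :: L) = simpleRefl n i * wordProd n L := by
  simp [wordProd]

theorem wordProd_append (n : ℕ) (L M : List ℕ) :
    wordProd n (L ++ M) = wordProd n L * wordProd n M := by
  simp [wordProd]

theorem isWord_cons {i : ℕ} {L : List ℕ} :
    IsWord n (i :: L) ↔ (1 ≤ i ∧ i ≤ n) ∧ IsWord n L := by
  simp [IsWord]

theorem isSigned_wordProd (hn : 2 ≤ n) {L : List ℕ} (hL : IsWord n L) :
    IsSigned n (wordProd n L) := by
  induction L with
  | nil => exact .one
  | cons i L ih =>
    rw [isWord_cons] at hL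
    rw [wordProd_cons]
    exact (isSigned_simpleRefl hn hL.1).mul (ih hL.2)

theorem wordProd_reverse (hn : 2 ≤ n) {L : List ℕ} (hL : IsWord n L) :
    wordProd n L.reverse = (wordProd n L)⁻¹ := by
  induction L with
  | nil => simp [wordProd]
  | cons i L ih =>
    rw [isWord_cons] at hL
    rw [List.reverse_cons, wordProd_append, ih hL.2, wordProd_cons, wordProd_cons, mul_inv_rev,
      simpleRefl_inv hn hL.1, wordProd_nil, mul_one]

theorem IsWord.reverse {L : List ℕ} (hL : IsWord n L) : IsWord n L.reverse :=
  fun i hi => hL i (List.mem_reverse.1 hi)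

/-- The strong exchange property. -/
theorem exists_wordProd_eq_signedSwap_mul (hn : 2 ≤ n) {L : List ℕ} (hL : IsWord n L) {a b : ℤ}
    (hab : IsRootPair n a b) (h : letterHeight n b < letterHeight n a)
    (h' : letterHeight n ((wordProd n L)⁻¹ a) < letterHeight n ((wordProd n L)⁻¹ b)) :
    ∃ M, IsWord n M ∧ M.length + 1 = L.length ∧ wordProd n M = signedSwap a b * wordProd n L := by
  induction L generalizing a b with
  | nil =>
    simp only [wordProd_nil, inv_one, Equiv.Perm.one_apply] at h'
    omega
  | cons i L ih =>
    rw [isWord_cons] at hL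
    have hs := isSigned_simpleRefl hn hL.1
    rw [wordProd_cons, mul_inv_rev, simpleRefl_inv hn hL.1, Equiv.Perm.mul_apply,
      Equiv.Perm.mul_apply] at h'
    have hab' := hs.isRootPair hab
    rcases lt_or_gt_of_ne (height_ne_of_isRootPair hab') with hlt | hgt
    · refine ⟨L, hL.2, rfl, ?_⟩
      have : signedSwap a b = simpleRefl n i := by
        rw [simpleRefl_eq_signedSwap]
        have hr := isRootPair_letters hn hL.1
        rcases eq_letters_of_height_lt hn hL.1 hab h hlt with ⟨rfl, rfl⟩ | ⟨rfl, rfl⟩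
        · rfl
        · exact signedSwap_neg _ _ hr.1.1 hr.2.1.1 hr.2.2.1 hr.2.2.2
      rw [this, wordProd_cons, simpleRefl_mul_cancel hn hL.1]
    · obtain ⟨M, hM, hlen, hprod⟩ := ih hL.2 hab' hgt h'
      refine ⟨i :: M, isWord_cons.2 ⟨hL.1, hM⟩, by simp [hlen], ?_⟩
      rw [wordProd_cons, hprod, wordProd_cons, ← mul_assoc, ← mul_assoc, hs.mul_signedSwap,
        simpleRefl_simpleRefl_apply hn hL.1, simpleRefl_simpleRefl_apply hn hL.1]

/-- A word of minimal length among the words with the same product. -/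
def IsMinWord (n : ℕ) (L : List ℕ) : Prop :=
  IsWord n L ∧ ∀ M, IsWord n M → wordProd n M = wordProd n L → L.length ≤ M.length

theorem IsReducedWord.isMinWord {w : Equiv.Perm ℤ} {L : List ℕ} (h : IsReducedWord n w L) :
    IsMinWord n L :=
  ⟨h.1, fun M hM hprod => h.2.2 ▸ Nat.sInf_le ⟨M, hM, rfl, hprod.trans h.2.1⟩⟩

/-- `i` is a left descent of `w`. -/
def IsDescent (n : ℕ) (w : Equiv.Perm ℤ) (i : ℕ) : Prop :=
  letterHeight n (w⁻¹ (fstLetter n i)) < letterHeight n (w⁻¹ (sndLetter n i))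

theorem height_letters (hn : 2 ≤ n) {i : ℕ} (hi : 1 ≤ i ∧ i ≤ n) :
    letterHeight n (fstLetter n i) = letterHeight n (sndLetter n i) + 1 := by
  have := letters_spec hn hi
  have := letterHeight_cases n (fstLetter n i)
  have := letterHeight_cases n (sndLetter n i)
  omega

theorem IsMinWord.of_length {L M : List ℕ} (hL : IsMinWord n L) (hM : IsWord n M)
    (h : wordProd n M = wordProd n L) (hlen : M.length = L.length) : IsMinWord n M :=
  ⟨hM, fun N hN hp => hlen ▸ hL.2 N hN (hp.trans h)⟩

theorem IsMinWord.tail {i : ℕ} {L : List ℕ} (h : IsMinWord n (i :: L)) :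
    IsMinWord n L := by
  refine ⟨(isWord_cons.1 h.1).2, fun M hM hp => ?_⟩
  have := h.2 (i :: M) (isWord_cons.2 ⟨(isWord_cons.1 h.1).1, hM⟩)
    (by rw [wordProd_cons, wordProd_cons, hp])
  simpa using this

theorem IsMinWord.exists_cons (hn : 2 ≤ n) {i : ℕ} (hi : 1 ≤ i ∧ i ≤ n) {L : List ℕ}
    (h : IsMinWord n L) (hd : IsDescent n (wordProd n L) i) :
    ∃ M, IsMinWord n (i :: M) ∧ wordProd n (i :: M) = wordProd n L ∧
      (i :: M).length = L.length := by
  obtain ⟨M, hM, hlen, hp⟩ := exists_wordProd_eq_signedSwap_mul hn h.1 (isRootPair_letters hn hi)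
    (by rw [height_letters hn hi]; omega) hd
  have hp' : wordProd n (i :: M) = wordProd n L := by
    rw [wordProd_cons, hp, ← simpleRefl_eq_signedSwap, simpleRefl_mul_cancel hn hi]
  exact ⟨M, h.of_length (isWord_cons.2 ⟨hi, hM⟩) hp' hlen, hp', hlen⟩

theorem IsMinWord.isDescent (hn : 2 ≤ n) {i : ℕ} {L : List ℕ} (h : IsMinWord n (i :: L)) :
    IsDescent n (wordProd n (i :: L)) i := by
  obtain ⟨hi, hL⟩ := isWord_cons.1 h.1
  have hs := isSigned_wordProd hn h.1
  rcases lt_or_gt_of_ne (height_ne_of_isRootPair (hs.inv.isRootPair (isRootPair_letters hn hi)))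
    with hlt | hgt
  · exact hlt
  exfalso
  have hfst : simpleRefl n i (fstLetter n i) = sndLetter n i := by simp [simpleRefl_apply hn hi]
  have hsnd : simpleRefl n i (sndLetter n i) = fstLetter n i := by
    rw [← hfst, simpleRefl_simpleRefl_apply hn hi]
  rw [wordProd_cons, mul_inv_rev, simpleRefl_inv hn hi, Equiv.Perm.mul_apply, Equiv.Perm.mul_apply,
    hfst, hsnd] at hgt
  obtain ⟨M, hM, hlen, hp⟩ := exists_wordProd_eq_signedSwap_mul hn hL (isRootPair_letters hn hi)
    (by rw [height_letters hn hi]; omega) hgt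
  have := h.2 M hM (by rw [hp, wordProd_cons, ← simpleRefl_eq_signedSwap])
  simp at this
  omega

theorem IsMinWord.not_isDescent_tail (hn : 2 ≤ n) {i : ℕ} {L : List ℕ} (h : IsMinWord n (i :: L)) :
    letterHeight n ((wordProd n L)⁻¹ (sndLetter n i)) <
      letterHeight n ((wordProd n L)⁻¹ (fstLetter n i)) := by
  obtain ⟨hi, hL⟩ := isWord_cons.1 h.1
  have hd := h.isDescent hn
  have hfst : simpleRefl n i (fstLetter n i) = sndLetter n i := by simp [simpleRefl_apply hn hi]
  have hsnd : simpleRefl n i (sndLetter n i) = fstLetter n i := by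
    rw [← hfst, simpleRefl_simpleRefl_apply hn hi]
  rwa [IsDescent, wordProd_cons, mul_inv_rev, simpleRefl_inv hn hi, Equiv.Perm.mul_apply,
    Equiv.Perm.mul_apply, hfst, hsnd] at hd

theorem IsMinWord.reverse (hn : 2 ≤ n) {L : List ℕ} (h : IsMinWord n L) :
    IsMinWord n L.reverse := by
  refine ⟨h.1.reverse, fun M hM hp => ?_⟩
  rw [wordProd_reverse hn h.1] at hp
  have := h.2 M.reverse hM.reverse (by rw [wordProd_reverse hn hM, hp, inv_inv])
  simpa using this

theorem IsMinWord.exists_append_singleton (hn : 2 ≤ n) {i : ℕ} (hi : 1 ≤ i ∧ i ≤ n) {L : List ℕ}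
    (h : IsMinWord n L) (hd : IsDescent n (wordProd n L)⁻¹ i) :
    ∃ M, IsMinWord n (M ++ [i]) ∧ wordProd n (M ++ [i]) = wordProd n L := by
  rw [← wordProd_reverse hn h.1] at hd
  obtain ⟨M, hM, hp, -⟩ := (h.reverse hn).exists_cons hn hi hd
  refine ⟨M.reverse, by simpa using hM.reverse hn, ?_⟩
  rw [← List.reverse_cons, wordProd_reverse hn hM.1, hp, wordProd_reverse hn h.1, inv_inv]

theorem IsMinWord.of_append_singleton (hn : 2 ≤ n) {i : ℕ} {L : List ℕ}
    (h : IsMinWord n (L ++ [i])) : IsMinWord n L := by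
  have := h.reverse hn
  rw [List.reverse_append] at this
  simpa using (this.tail).reverse hn

end Words

section Polynomials

variable {n : ℕ} {w v : Equiv.Perm ℤ}

/-- The linear polynomial `ε_a - ε_b`. -/
noncomputable def rootPoly (n : ℕ) (a b : ℤ) : MvPolynomial (Fin n) ℂ := epsPoly n a - epsPoly n b

theorem epsPoly_neg (n : ℕ) (a : ℤ) : epsPoly n (-a) = -epsPoly n a := by
  unfold epsPoly
  split_ifs <;> first | omega | simp

theorem epsPoly_eq_zero {a : ℤ} (h : (n : ℤ) < |a|) : epsPoly n a = 0 := by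
  rw [lt_abs] at h
  unfold epsPoly
  split_ifs <;> first | omega | rfl

theorem polyAct_epsPoly (hw : IsSigned n w) (a : ℤ) :
    polyAct n w (epsPoly n a) = epsPoly n (w a) := by
  rcases lt_or_ge (n : ℤ) |a| with h | h
  · rw [hw.fix a h, epsPoly_eq_zero h, map_zero]
  rw [abs_le] at h
  rcases lt_trichotomy a 0 with h0 | rfl | h0
  · have : epsPoly n a = -X (⟨(-a - 1).toNat, by omega⟩ : Fin n) := by
      rw [epsPoly, dif_neg (by omega), dif_pos (by omega)]
    rw [this, map_neg, polyAct, aeval_X, ← epsPoly_neg, ← hw.odd]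
    congr 2
    dsimp only
    omega
  · rw [hw.map_zero]
    simp [epsPoly]
  · have : epsPoly n a = X (⟨(a - 1).toNat, by omega⟩ : Fin n) := by
      rw [epsPoly, dif_pos (by omega)]
    rw [this, polyAct, aeval_X]
    congr 2
    dsimp only
    omega

theorem polyAct_rootPoly (hw : IsSigned n w) (a b : ℤ) :
    polyAct n w (rootPoly n a b) = rootPoly n (w a) (w b) := by
  rw [rootPoly, map_sub, polyAct_epsPoly hw, polyAct_epsPoly hw, rootPoly]

theorem rootPoly_neg_neg (n : ℕ) (a b : ℤ) : rootPoly n (-b) (-a) = rootPoly n a b := by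
  simp only [rootPoly, epsPoly_neg]
  ring

theorem rootPoly_swap (n : ℕ) (a b : ℤ) : rootPoly n b a = -rootPoly n a b := by
  simp [rootPoly]

theorem simpleRootPoly_eq (n i : ℕ) :
    simpleRootPoly n i = rootPoly n (fstLetter n i) (sndLetter n i) := by
  unfold simpleRootPoly rootPoly fstLetter sndLetter
  split_ifs
  · rfl
  · rw [epsPoly_neg, sub_neg_eq_add]

theorem polyAct_mul (hw : IsSigned n w) (v : Equiv.Perm ℤ) (p : MvPolynomial (Fin n) ℂ) :
    polyAct n (w * v) p = polyAct n w (polyAct n v p) := by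
  change _ = ((polyAct n w).comp (polyAct n v)) p
  congr 1
  ext1 k
  rw [AlgHom.comp_apply]
  unfold polyAct
  rw [aeval_X, aeval_X]
  exact (polyAct_epsPoly hw _).symm

theorem polyAct_one (p : MvPolynomial (Fin n) ℂ) : polyAct n 1 p = p := by
  change _ = (AlgHom.id ℂ _) p
  congr 1
  ext1 k
  unfold polyAct
  have := k.2
  rw [aeval_X, Equiv.Perm.one_apply, epsPoly, dif_pos (by omega)]
  simp

theorem polyAct_injective (hw : IsSigned n w) : Function.Injective (polyAct n w) := by
  refine Function.LeftInverse.injective (g := polyAct n w⁻¹) fun p => ?_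
  rw [← polyAct_mul hw.inv, inv_mul_cancel, polyAct_one]

/-- The values of the coordinates at the points used to separate roots. -/
theorem aeval_epsPoly (n : ℕ) (x : ℤ → ℂ) (hx : ∀ a, x (-a) = -x a) {a : ℤ} (ha : IsLetter n a) :
    aeval (fun k : Fin n => x ((k : ℕ) + 1)) (epsPoly n a) = x a := by
  obtain ⟨h0, h1, h2⟩ := ha
  rcases lt_or_gt_of_ne h0 with h | h
  · rw [epsPoly, dif_neg (by omega), dif_pos (by omega), map_neg, aeval_X, ← hx]
    congr 1
    dsimp only
    omega
  · rw [epsPoly, dif_pos (by omega), aeval_X]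
    congr 1
    dsimp only
    omega

theorem rootPoly_ne_zero_of_ne {a b : ℤ} (ha : IsLetter n a) (hb : IsLetter n b) (h : a ≠ b) :
    rootPoly n a b ≠ 0 := by
  intro h0
  let x : ℤ → ℂ := fun t => (t : ℂ)
  have h1 := congrArg (aeval (fun k : Fin n => x ((k : ℕ) + 1))) h0
  have hx : ∀ t, x (-t) = -x t := fun t => by simp [x]
  rw [rootPoly, map_sub, aeval_epsPoly n x hx ha, aeval_epsPoly n x hx hb, map_zero,
    sub_eq_zero] at h1
  exact h (Int.cast_injective (α := ℂ) h1)

theorem rootPoly_ne_zero {a b : ℤ} (h : IsRootPair n a b) : rootPoly n a b ≠ 0 :=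
  rootPoly_ne_zero_of_ne h.1 h.2.1 h.2.2.1

end Polynomials

section Action

variable {n i j : ℕ}

open Classical in
/-- The action of the simple reflection `sᵢ` on `ℂ(x₁, …, xₙ)`. -/
noncomputable def simpleAct (n i : ℕ) : KK n →+* KK n :=
  if h : Function.Injective (polyAct n (simpleRefl n i)) then
    IsFractionRing.map (A := MvPolynomial (Fin n) ℂ) (B := MvPolynomial (Fin n) ℂ)
      (j := (polyAct n (simpleRefl n i)).toRingHom) h
  else RingHom.id _

theorem simpleAct_algebraMap (hn : 2 ≤ n) (hi : 1 ≤ i ∧ i ≤ n) (p : MvPolynomial (Fin n) ℂ) :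
    simpleAct n i (algebraMap _ (KK n) p) = algebraMap _ (KK n) (polyAct n (simpleRefl n i) p) := by
  have h := polyAct_injective (isSigned_simpleRefl hn hi)
  rw [simpleAct, dif_pos h]
  exact IsLocalization.map_eq _ _

theorem KK.ringHom_ext {f g : KK n →+* KK n}
    (h : ∀ p : MvPolynomial (Fin n) ℂ, f (algebraMap _ _ p) = g (algebraMap _ _ p)) (x : KK n) :
    f x = g x :=
  RingHom.congr_fun (IsLocalization.ringHom_ext (nonZeroDivisors (MvPolynomial (Fin n) ℂ))
    (RingHom.ext h)) x

theorem simpleAct_simpleAct (hn : 2 ≤ n) (hi : 1 ≤ i ∧ i ≤ n) (x : KK n) :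
    simpleAct n i (simpleAct n i x) = x := by
  refine KK.ringHom_ext (f := (simpleAct n i).comp (simpleAct n i)) (g := RingHom.id _) ?_ x
  intro p
  simp only [RingHom.comp_apply, RingHom.id_apply, simpleAct_algebraMap hn hi,
    ← polyAct_mul (isSigned_simpleRefl hn hi), simpleRefl_mul_self hn hi, polyAct_one]

/-- The root `ε_a - ε_b` as an element of `ℂ(x₁, …, xₙ)`. -/
noncomputable def rootElem (n : ℕ) (a b : ℤ) : KK n := algebraMap _ _ (rootPoly n a b)

theorem simpleAct_rootElem (hn : 2 ≤ n) (hi : 1 ≤ i ∧ i ≤ n) (a b : ℤ) :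
    simpleAct n i (rootElem n a b) = rootElem n (simpleRefl n i a) (simpleRefl n i b) := by
  rw [rootElem, simpleAct_algebraMap hn hi, polyAct_rootPoly (isSigned_simpleRefl hn hi), rootElem]

theorem rootElem_ne_zero {a b : ℤ} (h : IsRootPair n a b) : rootElem n a b ≠ 0 := by
  rw [rootElem, Ne, IsFractionRing.to_map_eq_zero_iff]
  exact rootPoly_ne_zero h

theorem rootElem_swap (n : ℕ) (a b : ℤ) : rootElem n b a = -rootElem n a b := by
  rw [rootElem, rootPoly_swap, map_neg, rootElem]

theorem rootElem_neg_neg (n : ℕ) (a b : ℤ) : rootElem n (-b) (-a) = rootElem n a b := by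
  rw [rootElem, rootPoly_neg_neg, rootElem]

theorem rootElem_add (n : ℕ) (a b c : ℤ) :
    rootElem n a c = rootElem n a b + rootElem n b c := by
  simp only [rootElem, ← map_add]
  congr 1
  simp [rootPoly]

/-- The simple root `αᵢ` as an element of `ℂ(x₁, …, xₙ)`. -/
noncomputable def simpleElem (n i : ℕ) : KK n := rootElem n (fstLetter n i) (sndLetter n i)

theorem simpleElem_ne_zero (hn : 2 ≤ n) (hi : 1 ≤ i ∧ i ≤ n) : simpleElem n i ≠ 0 :=
  rootElem_ne_zero (isRootPair_letters hn hi)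

theorem simpleRefl_fst (hn : 2 ≤ n) (hi : 1 ≤ i ∧ i ≤ n) :
    simpleRefl n i (fstLetter n i) = sndLetter n i := by
  simp [simpleRefl_apply hn hi]

theorem simpleRefl_snd (hn : 2 ≤ n) (hi : 1 ≤ i ∧ i ≤ n) :
    simpleRefl n i (sndLetter n i) = fstLetter n i := by
  rw [← simpleRefl_fst hn hi, simpleRefl_simpleRefl_apply hn hi]

theorem simpleAct_simpleElem_self (hn : 2 ≤ n) (hi : 1 ≤ i ∧ i ≤ n) :
    simpleAct n i (simpleElem n i) = -simpleElem n i := by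
  rw [simpleElem, simpleAct_rootElem hn hi, simpleRefl_fst hn hi, simpleRefl_snd hn hi,
    rootElem_swap]

/-- Left multiplication by the divided difference operator `αᵢ⁻¹ (1 - sᵢ)`, on the coefficients of
elements of the twisted group algebra. -/
noncomputable def divDiff (n i : ℕ) (f : Equiv.Perm ℤ → KK n) : Equiv.Perm ℤ → KK n :=
  fun v => (simpleElem n i)⁻¹ * (f v - simpleAct n i (f (simpleRefl n i * v)))

open Classical in
/-- The coefficients of the product of the divided difference operators of a word. -/
noncomputable def wordCoeff (n : ℕ) : List ℕ → Equiv.Perm ℤ → KK n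
  | [] => fun v => if v = 1 then 1 else 0
  | i :: L => divDiff n i (wordCoeff n L)

/-- The simple reflections `sᵢ` and `sⱼ` commute and are orthogonal. -/
def IsOrthogonal (n i j : ℕ) : Prop :=
  (simpleRefl n i (fstLetter n j) = fstLetter n j ∧
    simpleRefl n i (sndLetter n j) = sndLetter n j) ∨
  (simpleRefl n i (fstLetter n j) = -sndLetter n j ∧
    simpleRefl n i (sndLetter n j) = -fstLetter n j)

/-- The simple roots `αᵢ = ε_p - ε_q` and `αⱼ = ε_q - ε_r` are consecutive. -/
def IsConsecutive (n i j : ℕ) : Prop :=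
  sndLetter n i = fstLetter n j ∧ simpleRefl n i (fstLetter n j) = fstLetter n i ∧
    simpleRefl n i (sndLetter n j) = sndLetter n j ∧
    simpleRefl n j (fstLetter n i) = fstLetter n i ∧
    simpleRefl n j (sndLetter n i) = sndLetter n j

theorem orthogonal_or_consecutive (hn : 2 ≤ n) (hi : 1 ≤ i ∧ i ≤ n) (hj : 1 ≤ j ∧ j ≤ n)
    (hij : i ≠ j) :
    (IsOrthogonal n i j ∧ IsOrthogonal n j i) ∨ IsConsecutive n i j ∨ IsConsecutive n j i := by
  wlog h : i < j generalizing i j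
  · rcases this hj hi hij.symm (by omega) with h | h | h
    · exact Or.inl h.symm
    · exact Or.inr (Or.inr h)
    · exact Or.inr (Or.inl h)
  have e1 : fstLetter n i = i := if_pos (by omega)
  have e2 : sndLetter n i = i + 1 := if_pos (by omega)
  have e3 : (fstLetter n j = j ∧ sndLetter n j = j + 1 ∧ j < n) ∨
      (fstLetter n j = n - 1 ∧ sndLetter n j = -n ∧ j = n) := by
    unfold fstLetter sndLetter
    split_ifs <;> omega
  have a1 := simpleRefl_cases hn hi (fstLetter n j)
  have a2 := simpleRefl_cases hn hi (sndLetter n j)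
  have a3 := simpleRefl_cases hn hj (fstLetter n i)
  have a4 := simpleRefl_cases hn hj (sndLetter n i)
  unfold IsOrthogonal IsConsecutive
  rcases e3 with e3 | e3
  · rcases eq_or_ne j (i + 1) with h | h
    · right; left; omega
    · left; omega
  · rcases eq_or_ne i (n - 1) with h | h
    · left; omega
    rcases eq_or_ne (i + 1) (n - 1) with h | h
    · right; left; omega
    · left; omega

theorem IsOrthogonal.simpleElem (hn : 2 ≤ n) (hi : 1 ≤ i ∧ i ≤ n) (h : IsOrthogonal n i j) :
    simpleAct n i (simpleElem n j) = simpleElem n j := by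
  rw [_root_.simpleElem, simpleAct_rootElem hn hi]
  rcases h with ⟨h1, h2⟩ | ⟨h1, h2⟩ <;> rw [h1, h2]
  rw [rootElem_neg_neg]

theorem IsOrthogonal.mul_comm (hn : 2 ≤ n) (hi : 1 ≤ i ∧ i ≤ n) (hj : 1 ≤ j ∧ j ≤ n)
    (h : IsOrthogonal n i j) :
    simpleRefl n i * simpleRefl n j = simpleRefl n j * simpleRefl n i := by
  have hr := isRootPair_letters hn hj
  nth_rw 1 [simpleRefl_eq_signedSwap n j]
  rw [(isSigned_simpleRefl hn hi).mul_signedSwap, simpleRefl_eq_signedSwap n j]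
  rcases h with ⟨h1, h2⟩ | ⟨h1, h2⟩ <;> rw [h1, h2]
  rw [signedSwap_neg _ _ hr.1.1 hr.2.1.1 hr.2.2.1 hr.2.2.2]

theorem simpleAct_comm (hn : 2 ≤ n) (hi : 1 ≤ i ∧ i ≤ n) (hj : 1 ≤ j ∧ j ≤ n)
    (h : simpleRefl n i * simpleRefl n j = simpleRefl n j * simpleRefl n i) (x : KK n) :
    simpleAct n i (simpleAct n j x) = simpleAct n j (simpleAct n i x) := by
  refine KK.ringHom_ext (f := (simpleAct n i).comp (simpleAct n j))
    (g := (simpleAct n j).comp (simpleAct n i)) (fun p => ?_) x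
  simp only [RingHom.comp_apply, simpleAct_algebraMap hn hi, simpleAct_algebraMap hn hj,
    ← polyAct_mul (isSigned_simpleRefl hn hi), ← polyAct_mul (isSigned_simpleRefl hn hj), h]

theorem simpleAct_braid (hn : 2 ≤ n) (hi : 1 ≤ i ∧ i ≤ n) (hj : 1 ≤ j ∧ j ≤ n)
    (h : simpleRefl n i * (simpleRefl n j * simpleRefl n i) =
      simpleRefl n j * (simpleRefl n i * simpleRefl n j)) (x : KK n) :
    simpleAct n i (simpleAct n j (simpleAct n i x)) =
      simpleAct n j (simpleAct n i (simpleAct n j x)) := by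
  refine KK.ringHom_ext (f := (simpleAct n i).comp ((simpleAct n j).comp (simpleAct n i)))
    (g := (simpleAct n j).comp ((simpleAct n i).comp (simpleAct n j))) (fun p => ?_) x
  simp only [RingHom.comp_apply, simpleAct_algebraMap hn hi, simpleAct_algebraMap hn hj,
    ← polyAct_mul (isSigned_simpleRefl hn hi), ← polyAct_mul (isSigned_simpleRefl hn hj), h]

theorem IsOrthogonal.divDiff_comm (hn : 2 ≤ n) (hi : 1 ≤ i ∧ i ≤ n) (hj : 1 ≤ j ∧ j ≤ n)
    (h : IsOrthogonal n i j) (h' : IsOrthogonal n j i) (f : Equiv.Perm ℤ → KK n) :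
    divDiff n i (divDiff n j f) = divDiff n j (divDiff n i f) := by
  funext v
  have hm := h.mul_comm hn hi hj
  have e1 : simpleRefl n j * (simpleRefl n i * v) = simpleRefl n i * (simpleRefl n j * v) := by
    rw [← mul_assoc, ← hm, mul_assoc]
  simp only [divDiff, map_mul, map_sub, map_inv₀, h.simpleElem hn hi, h'.simpleElem hn hj, e1,
    simpleAct_comm hn hi hj hm]
  ring

theorem IsConsecutive.braid (hn : 2 ≤ n) (hi : 1 ≤ i ∧ i ≤ n) (hj : 1 ≤ j ∧ j ≤ n)
    (h : IsConsecutive n i j) :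
    simpleRefl n i * (simpleRefl n j * simpleRefl n i) =
      simpleRefl n j * (simpleRefl n i * simpleRefl n j) := by
  obtain ⟨h0, h1, h2, h3, h4⟩ := h
  rw [← mul_assoc, ← mul_assoc]
  have e1 : simpleRefl n i * simpleRefl n j =
      signedSwap (fstLetter n i) (sndLetter n j) * simpleRefl n i := by
    nth_rw 1 [simpleRefl_eq_signedSwap n j]
    rw [(isSigned_simpleRefl hn hi).mul_signedSwap, h1, h2]
  have e2 : simpleRefl n j * simpleRefl n i =
      signedSwap (fstLetter n i) (sndLetter n j) * simpleRefl n j := by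
    nth_rw 1 [simpleRefl_eq_signedSwap n i]
    rw [(isSigned_simpleRefl hn hj).mul_signedSwap, h3, h4]
  rw [e1, e2, mul_assoc, mul_assoc, simpleRefl_mul_self hn hi, simpleRefl_mul_self hn hj]

theorem IsConsecutive.divDiff_braid (hn : 2 ≤ n) (hi : 1 ≤ i ∧ i ≤ n) (hj : 1 ≤ j ∧ j ≤ n)
    (h : IsConsecutive n i j) (f : Equiv.Perm ℤ → KK n) :
    divDiff n i (divDiff n j (divDiff n i f)) = divDiff n j (divDiff n i (divDiff n j f)) := by
  funext v
  have hm := h.braid hn hi hj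
  obtain ⟨h0, h1, h2, h3, h4⟩ := h
  have e1 : simpleRefl n i * (simpleRefl n j * (simpleRefl n i * v)) =
      simpleRefl n j * (simpleRefl n i * (simpleRefl n j * v)) := by
    simpa only [mul_assoc] using congrArg (· * v) hm
  have hadd : rootElem n (fstLetter n i) (sndLetter n j) = simpleElem n i + simpleElem n j := by
    rw [rootElem_add n _ (fstLetter n j), simpleElem, simpleElem, h0]
  have hij : simpleAct n i (simpleElem n j) = simpleElem n i + simpleElem n j := by
    rw [← hadd]
    rw [simpleElem, simpleAct_rootElem hn hi, h1, h2]
  have hji : simpleAct n j (simpleElem n i) = simpleElem n i + simpleElem n j := by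
    rw [← hadd]
    rw [simpleElem, simpleAct_rootElem hn hj, h3, h4]
  have n1 := simpleElem_ne_zero hn hi
  have n2 := simpleElem_ne_zero hn hj
  have n3 : simpleElem n i + simpleElem n j ≠ 0 := by
    rw [← hij]
    exact (map_ne_zero _).2 n2
  simp only [divDiff, map_mul, map_sub, map_add, map_inv₀, hij, hji,
    simpleAct_simpleElem_self hn hi,
    simpleAct_simpleElem_self hn hj, e1, simpleAct_braid hn hi hj hm,
    simpleAct_simpleAct hn hi, simpleAct_simpleAct hn hj, simpleRefl_mul_cancel hn hi,
    simpleRefl_mul_cancel hn hj]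
  have n4 : -simpleElem n i + (simpleElem n i + simpleElem n j) ≠ 0 := by simpa using n2
  have n5 : simpleElem n i + simpleElem n j + -simpleElem n j ≠ 0 := by simpa using n1
  generalize simpleElem n i = a at *
  generalize simpleElem n j = b at *
  rw [show -a + (a + b) = b by ring, show a + b + -b = a by ring]
  field_simp
  ring

theorem wordCoeff_cons (n i : ℕ) (L : List ℕ) :
    wordCoeff n (i :: L) = divDiff n i (wordCoeff n L) := rfl

theorem IsOrthogonal.isDescent (hn : 2 ≤ n) (hi : 1 ≤ i ∧ i ≤ n) (hj : 1 ≤ j ∧ j ≤ n)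
    (h : IsOrthogonal n i j) {w : Equiv.Perm ℤ} (hw : IsSigned n w) (hd : IsDescent n w j) :
    IsDescent n (simpleRefl n i * w) j := by
  unfold IsDescent at hd ⊢
  rw [mul_inv_rev, simpleRefl_inv hn hi, Equiv.Perm.mul_apply, Equiv.Perm.mul_apply]
  rcases h with ⟨h1, h2⟩ | ⟨h1, h2⟩ <;> rw [h1, h2]
  · exact hd
  have hr := hw.inv.isRootPair (isRootPair_letters hn hj)
  rw [hw.inv.odd, hw.inv.odd]
  have := letterHeight_cases n (w⁻¹ (fstLetter n j))
  have := letterHeight_cases n (w⁻¹ (sndLetter n j))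
  have := letterHeight_cases n (-w⁻¹ (fstLetter n j))
  have := letterHeight_cases n (-w⁻¹ (sndLetter n j))
  unfold IsRootPair IsLetter at hr
  omega

/-- Coefficients computed from reduced words depend only on the product of the word. -/
theorem IsMinWord.wordCoeff_eq (hn : 2 ≤ n) {L M : List ℕ} (hL : IsMinWord n L)
    (hM : IsMinWord n M) (h : wordProd n L = wordProd n M) : wordCoeff n L = wordCoeff n M := by
  have hlen : L.length = M.length := le_antisymm (hL.2 M hM.1 h.symm) (hM.2 L hL.1 h)
  induction hl : L.length using Nat.strong_induction_on generalizing L M with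
  | _ l ih =>
  rcases L with _ | ⟨i, A⟩
  · rw [List.eq_nil_of_length_eq_zero hlen.symm]
  rcases M with _ | ⟨j, B⟩
  · simp at hlen
  simp only [List.length_cons] at hl hlen
  have hA := hL.tail
  have hB := hM.tail
  have hi := (isWord_cons.1 hL.1).1
  have hj := (isWord_cons.1 hM.1).1
  have hdi := hL.isDescent hn
  have hdj := hM.isDescent hn
  have hw := isSigned_wordProd hn hL.1
  have heqA : wordProd n A = simpleRefl n i * wordProd n (i :: A) := by
    rw [wordProd_cons, simpleRefl_mul_cancel hn hi]
  have heqB : wordProd n B = simpleRefl n j * wordProd n (i :: A) := by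
    rw [h, wordProd_cons, simpleRefl_mul_cancel hn hj]
  rw [← h] at hdj
  rcases eq_or_ne i j with rfl | hij
  · rw [wordCoeff_cons, wordCoeff_cons,
      ih A.length (by omega) hA hB (heqA.trans heqB.symm) (by omega) rfl]
  have key : ∀ {i j : ℕ} {A B : List ℕ}, IsMinWord n (i :: A) → IsMinWord n (j :: B) →
      A.length + 1 = l → B.length = A.length → wordProd n (i :: A) = wordProd n (j :: B) →
      IsConsecutive n i j → wordCoeff n (i :: A) = wordCoeff n (j :: B) := by
    intro i j A B hL hM hl hlen h hcons
    have hi := (isWord_cons.1 hL.1).1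
    have hj := (isWord_cons.1 hM.1).1
    have hb := hcons.braid hn hi hj
    have hdi := hL.isDescent hn
    have hdj := hM.isDescent hn
    have heqA : wordProd n A = simpleRefl n i * wordProd n (i :: A) := by
      rw [wordProd_cons, simpleRefl_mul_cancel hn hi]
    have heqB : wordProd n B = simpleRefl n j * wordProd n (i :: A) := by
      rw [h, wordProd_cons, simpleRefl_mul_cancel hn hj]
    rw [← h] at hdj
    have hcons' := hcons
    obtain ⟨h0, h1, h2, h3, h4⟩ := hcons
    obtain ⟨C, hC, hCp, hCl⟩ := hL.tail.exists_cons hn hj (by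
      unfold IsDescent at hdi hdj ⊢
      rw [heqA, mul_inv_rev, simpleRefl_inv hn hi, Equiv.Perm.mul_apply, Equiv.Perm.mul_apply, h1,
        h2]
      rw [h0] at hdi
      exact hdi.trans hdj)
    have heqC : wordProd n C = simpleRefl n j * (simpleRefl n i * wordProd n (i :: A)) := by
      rw [← heqA, ← hCp, wordProd_cons, simpleRefl_mul_cancel hn hj]
    obtain ⟨E, hE, hEp, hEl⟩ := hC.tail.exists_cons hn hi (by
      unfold IsDescent at hdi hdj ⊢
      rw [heqC, mul_inv_rev, mul_inv_rev, simpleRefl_inv hn hi, simpleRefl_inv hn hj,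
        Equiv.Perm.mul_apply, Equiv.Perm.mul_apply, Equiv.Perm.mul_apply, Equiv.Perm.mul_apply, h3,
        h4, h2, simpleRefl_fst hn hi, h0]
      exact hdj)
    have hEl' : E.length + 2 = A.length := by
      simp only [List.length_cons] at hCl hEl
      omega
    have hprod : wordProd n (i :: j :: i :: E) = wordProd n (i :: A) := by
      rw [wordProd_cons, wordProd_cons, hEp, ← wordProd_cons n j, hCp, wordProd_cons]
    have hprod' : wordProd n (j :: i :: j :: E) = wordProd n (i :: A) := by
      rw [← hprod]
      simp only [wordProd_cons]
      simpa only [mul_assoc] using (congrArg (· * wordProd n E) hb).symm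
    have hwE : IsWord n E := (isWord_cons.1 hE.1).2
    have m1 : IsMinWord n (i :: j :: i :: E) := hL.of_length
      (isWord_cons.2 ⟨hi, isWord_cons.2 ⟨hj, hE.1⟩⟩) hprod (by simp; omega)
    have m2 : IsMinWord n (j :: i :: j :: E) := hL.of_length
      (isWord_cons.2 ⟨hj, isWord_cons.2 ⟨hi, isWord_cons.2 ⟨hj, hwE⟩⟩⟩) hprod' (by simp; omega)
    have c1 : wordCoeff n A = wordCoeff n (j :: i :: E) :=
      ih A.length (by omega) hL.tail m1.tail
        (mul_left_cancel (a := simpleRefl n i) (by rw [← wordProd_cons, ← wordProd_cons, hprod]))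
        (by simp; omega) rfl
    have c2 : wordCoeff n B = wordCoeff n (i :: j :: E) :=
      ih B.length (by omega) hM.tail m2.tail
        (mul_left_cancel (a := simpleRefl n j)
          (by rw [← wordProd_cons, ← wordProd_cons, hprod', h]))
        (by simp; omega) rfl
    rw [wordCoeff_cons, c1, wordCoeff_cons n j B, c2]
    simp only [wordCoeff_cons]
    exact hcons'.divDiff_braid hn hi hj _
  rcases orthogonal_or_consecutive hn hi hj hij with ⟨ho, ho'⟩ | hc | hc
  · obtain ⟨C, hC, hCp, hCl⟩ := hA.exists_cons hn hj (by
      rw [heqA]; exact ho.isDescent hn hi hj hw hdj)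
    simp only [List.length_cons] at hCl
    have hwC : IsWord n C := (isWord_cons.1 hC.1).2
    have hprod : wordProd n (j :: i :: C) = wordProd n (i :: A) := by
      rw [wordProd_cons, wordProd_cons, ← mul_assoc, ← ho.mul_comm hn hi hj, mul_assoc,
        ← wordProd_cons, hCp, wordProd_cons]
    have m2 : IsMinWord n (j :: i :: C) := hL.of_length
      (isWord_cons.2 ⟨hj, isWord_cons.2 ⟨hi, hwC⟩⟩) hprod (by simp; omega)
    have c1 : wordCoeff n A = wordCoeff n (j :: C) :=
      ih A.length (by omega) hA hC hCp.symm (by simp; omega) rfl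
    have c2 : wordCoeff n B = wordCoeff n (i :: C) :=
      ih B.length (by omega) hB m2.tail
        (mul_left_cancel (a := simpleRefl n j)
          (by rw [← wordProd_cons, ← wordProd_cons, hprod, h]))
        (by simp; omega) rfl
    rw [wordCoeff_cons, c1, wordCoeff_cons n j B, c2]
    simp only [wordCoeff_cons]
    exact ho.divDiff_comm hn hi hj ho' _
  · exact key hL hM hl (by omega) h hc
  · exact (key hM hL (by omega) (by omega) h.symm hc).symm

end Action

section Link

variable {n i : ℕ}

theorem maskedPrefix_cons (n i : ℕ) (L : List ℕ) (E : ℕ → Bool) (k : ℕ) :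
    maskedPrefix n (i :: L) E (k + 1) =
      (if E 0 then simpleRefl n i else 1) * maskedPrefix n L (fun m => E (m + 1)) k := by
  simp [maskedPrefix, List.range_succ_eq_map, Function.comp_def]

/-- The contribution of an exponent pattern to the coefficients of a word. -/
noncomputable def maskTerm (n : ℕ) (L : List ℕ) (E : ℕ → Bool) : KK n :=
  ∏ k ∈ Finset.range L.length, (algebraMap (MvPolynomial (Fin n) ℂ) (KK n)
    (polyAct n (maskedPrefix n L E (k + 1)) (simpleRootPoly n (L.getD k 0))))⁻¹

theorem maskTerm_cons_of_false {L : List ℕ} {E : ℕ → Bool} (h : E 0 = false) :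
    maskTerm n (i :: L) E = (simpleElem n i)⁻¹ * maskTerm n L (fun m => E (m + 1)) := by
  rw [maskTerm, List.length_cons, Finset.prod_range_succ', mul_comm, maskTerm]
  simp only [maskedPrefix_cons, h, Bool.false_eq_true, if_false, one_mul, List.getD_cons_succ,
    List.getD_cons_zero]
  congr 2
  rw [simpleElem, rootElem, simpleRootPoly_eq]
  exact congrArg _ (polyAct_one _)

theorem maskTerm_cons_of_true (hn : 2 ≤ n) (hi : 1 ≤ i ∧ i ≤ n) {L : List ℕ} {E : ℕ → Bool}
    (h : E 0 = true) :
    maskTerm n (i :: L) E =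
      -((simpleElem n i)⁻¹ * simpleAct n i (maskTerm n L (fun m => E (m + 1)))) := by
  have hs := isSigned_simpleRefl hn hi
  rw [maskTerm, List.length_cons, Finset.prod_range_succ', mul_comm, maskTerm, map_prod,
    ← neg_mul]
  simp only [maskedPrefix_cons, h, if_true, List.getD_cons_succ, List.getD_cons_zero,
    polyAct_mul hs, map_inv₀, simpleAct_algebraMap hn hi]
  congr 1
  rw [← inv_neg, ← simpleAct_simpleElem_self hn hi, simpleElem, rootElem,
    simpleAct_algebraMap hn hi, simpleRootPoly_eq]
  exact congrArg (fun p => (algebraMap _ (KK n) (polyAct n _ p))⁻¹) (polyAct_one _)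

/-- An exponent pattern on the positions of a word, extended by `0`. -/
def extendMask {l : ℕ} (E : Fin l → Bool) (m : ℕ) : Bool := if h : m < l then E ⟨m, h⟩ else false

theorem extendMask_cons_zero {l : ℕ} (b : Bool) (E : Fin l → Bool) :
    extendMask (Fin.cons b E : Fin (l + 1) → Bool) 0 = b := by
  simp [extendMask]

theorem extendMask_cons_succ {l : ℕ} (b : Bool) (E : Fin l → Bool) :
    (fun m => extendMask (Fin.cons b E : Fin (l + 1) → Bool) (m + 1)) = extendMask E := by
  funext m
  by_cases h : m < l
  · rw [extendMask, extendMask, dif_pos (by omega), dif_pos h]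
    exact Fin.cons_succ (α := fun _ => Bool) b E ⟨m, h⟩
  · rw [extendMask, extendMask, dif_neg (by omega), dif_neg h]

open Classical in
theorem sum_maskTerm_eq_wordCoeff (hn : 2 ≤ n) {L : List ℕ} (hL : IsWord n L)
    (v : Equiv.Perm ℤ) :
    (∑ E : Fin L.length → Bool,
      if maskedPrefix n L (extendMask E) L.length = v then maskTerm n L (extendMask E) else 0) =
      wordCoeff n L v := by
  induction L generalizing v with
  | nil =>
    simp only [maskTerm, maskedPrefix, wordCoeff, List.length_nil, List.range_zero, List.map_nil,
      List.prod_nil, Finset.range_zero, Finset.prod_empty, Finset.univ_unique,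
      Finset.sum_singleton]
    exact if_congr eq_comm rfl rfl
  | cons i L ih =>
    obtain ⟨hi, hL⟩ := isWord_cons.1 hL
    rw [wordCoeff_cons, divDiff, ← ih hL, ← ih hL, map_sum]
    simp only [List.length_cons]
    rw [← (Fin.consEquiv (fun _ : Fin (L.length + 1) => Bool)).sum_comp, Fintype.sum_prod_type,
      Fintype.sum_bool, mul_sub, Finset.mul_sum, Finset.mul_sum, add_comm, sub_eq_add_neg,
      ← Finset.sum_neg_distrib]
    congr 1 <;> refine Finset.sum_congr rfl fun E _ => ?_
    · change (if maskedPrefix n (i :: L) (extendMask (Fin.cons false E : Fin (L.length + 1) → Bool))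
        (L.length + 1) = v then maskTerm n (i :: L)
          (extendMask (Fin.cons false E : Fin (L.length + 1) → Bool)) else 0) = _
      rw [maskedPrefix_cons, maskTerm_cons_of_false (extendMask_cons_zero _ _),
        extendMask_cons_succ, extendMask_cons_zero]
      simp
    · change (if maskedPrefix n (i :: L) (extendMask (Fin.cons true E : Fin (L.length + 1) → Bool))
        (L.length + 1) = v then maskTerm n (i :: L)
          (extendMask (Fin.cons true E : Fin (L.length + 1) → Bool)) else 0) = _
      rw [maskedPrefix_cons, maskTerm_cons_of_true hn hi (extendMask_cons_zero _ _),
        extendMask_cons_succ, extendMask_cons_zero, if_pos rfl]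
      have : simpleRefl n i * maskedPrefix n L (extendMask E) L.length = v ↔
          maskedPrefix n L (extendMask E) L.length = simpleRefl n i * v := by
        constructor
        · rintro rfl
          rw [simpleRefl_mul_cancel hn hi]
        · intro h
          rw [h, simpleRefl_mul_cancel hn hi]
      simp only [this]
      split_ifs <;> simp

theorem dElem_eq (hn : 2 ≤ n) {L : List ℕ} (hL : IsWord n L) :
    dElem n L = wordCoeff n L 1 * algebraMap _ (KK n) (prodPosRoots n) := by
  classical
  have h : cElem n L 1 = (-1 : KK n) ^ L.length * wordCoeff n L 1 := by
    rw [← sum_maskTerm_eq_wordCoeff hn hL, cElem]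
    refine congrArg _ (Finset.sum_congr rfl fun E _ => ?_)
    exact if_congr Iff.rfl rfl rfl
  rw [dElem, h, ← mul_assoc, ← mul_pow]
  simp

theorem epsPoly_succ {n : ℕ} (k : Fin n) : epsPoly n ((k : ℕ) + 1) = X k := by
  rw [epsPoly, dif_pos (by omega)]
  simp

theorem prodPosRoots_ne_zero (n : ℕ) : prodPosRoots n ≠ 0 := by
  refine Finset.prod_ne_zero_iff.2 fun p hp => ?_
  have hlt := (Finset.mem_filter.1 hp).2
  refine mul_ne_zero ?_ ?_
  · have := rootPoly_ne_zero (n := n) (a := (p.1 : ℕ) + 1) (b := (p.2 : ℕ) + 1) (by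
      have := Fin.lt_def.1 hlt
      refine ⟨⟨?_, ?_, ?_⟩, ⟨?_, ?_, ?_⟩, ?_, ?_⟩ <;> omega)
    rwa [rootPoly, epsPoly_succ, epsPoly_succ] at this
  · have := rootPoly_ne_zero (n := n) (a := (p.1 : ℕ) + 1) (b := -((p.2 : ℕ) + 1)) (by
      have := Fin.lt_def.1 hlt
      refine ⟨⟨?_, ?_, ?_⟩, ⟨?_, ?_, ?_⟩, ?_, ?_⟩ <;> omega)
    rwa [rootPoly, epsPoly_neg, epsPoly_succ, epsPoly_succ, sub_neg_eq_add] at this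

end Link

section Support

variable {n i : ℕ}

theorem simpleRefl_ne_one (hn : 2 ≤ n) (hi : 1 ≤ i ∧ i ≤ n) : simpleRefl n i ≠ 1 := fun h =>
  (isRootPair_letters hn hi).2.2.1 (by
    rw [← simpleRefl_fst hn hi, h, Equiv.Perm.one_apply])

/-- Multiplying by a divided difference operator on the right. -/
theorem wordCoeff_append_singleton (hn : 2 ≤ n) (hi : 1 ≤ i ∧ i ≤ n) {L : List ℕ}
    (hL : IsWord n L) (v : Equiv.Perm ℤ) :
    wordCoeff n (L ++ [i]) v = (rootElem n (v (fstLetter n i)) (v (sndLetter n i)))⁻¹ *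
      (wordCoeff n L v + wordCoeff n L (v * simpleRefl n i)) := by
  induction L generalizing v with
  | nil =>
    have h1 := simpleRefl_ne_one hn hi
    simp only [List.nil_append, wordCoeff, divDiff]
    by_cases hv : v = 1
    · subst hv
      simp [h1, simpleElem]
    by_cases hv' : v = simpleRefl n i
    · subst hv'
      rw [simpleRefl_mul_self hn hi, simpleRefl_fst hn hi, simpleRefl_snd hn hi, rootElem_swap,
        simpleElem]
      simp [h1, neg_inv, -inv_neg]
    · have h2 : simpleRefl n i * v ≠ 1 := fun h => hv' (by
        rw [← simpleRefl_inv hn hi]; exact eq_inv_of_mul_eq_one_right h)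
      have h3 : v * simpleRefl n i ≠ 1 := fun h => hv' (by
        rw [← simpleRefl_inv hn hi]; exact eq_inv_of_mul_eq_one_left h)
      simp [hv, h2, h3]
  | cons j L ih =>
    obtain ⟨hj, hL⟩ := isWord_cons.1 hL
    simp only [List.cons_append, wordCoeff_cons, divDiff]
    rw [ih hL, ih hL, map_mul, map_inv₀, simpleAct_rootElem hn hj]
    simp only [Equiv.Perm.mul_apply, simpleRefl_simpleRefl_apply hn hj, map_add, mul_assoc]
    ring

theorem exists_sublist_of_wordCoeff_ne_zero (hn : 2 ≤ n) {L : List ℕ} (hL : IsWord n L)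
    {v : Equiv.Perm ℤ} (h : wordCoeff n L v ≠ 0) :
    ∃ M, List.Sublist M L ∧ wordProd n M = v := by
  induction L generalizing v with
  | nil =>
    refine ⟨[], List.Sublist.refl _, ?_⟩
    simp only [wordCoeff, ne_eq, ite_eq_right_iff, one_ne_zero, imp_false, not_not] at h
    exact h.symm
  | cons i L ih =>
    obtain ⟨hi, hL⟩ := isWord_cons.1 hL
    by_cases h1 : wordCoeff n L v = 0
    · by_cases h2 : wordCoeff n L (simpleRefl n i * v) = 0
      · simp [wordCoeff_cons, divDiff, h1, h2] at h
      · obtain ⟨M, hM, hv⟩ := ih hL h2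
        refine ⟨i :: M, hM.cons_cons i, ?_⟩
        rw [wordProd_cons, hv, simpleRefl_mul_cancel hn hi]
    · obtain ⟨M, hM, hv⟩ := ih hL h1
      exact ⟨M, hM.cons i, hv⟩

end Support

section Level

variable {n i : ℕ} {m : ℤ} {w v : Equiv.Perm ℤ}

/-- `w` fixes the letters `1, …, m - 1`. -/
def FixesBelow (m : ℤ) (w : Equiv.Perm ℤ) : Prop := ∀ a, 1 ≤ a → a < m → w a = a

theorem FixesBelow.mul (hw : FixesBelow m w) (hv : FixesBelow m v) : FixesBelow m (w * v) :=
  fun a h h' => by rw [Equiv.Perm.mul_apply, hv a h h', hw a h h']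

theorem FixesBelow.inv (hw : FixesBelow m w) : FixesBelow m w⁻¹ := fun a h h' => by
  rw [Equiv.Perm.inv_eq_iff_eq, hw a h h']

theorem FixesBelow.succ (hw : FixesBelow m w) (h : w m = m) : FixesBelow (m + 1) w :=
  fun a h1 h2 => by
    rcases eq_or_ne a m with rfl | h3
    · exact h
    · exact hw a h1 (by omega)

theorem FixesBelow.ge (hw : FixesBelow m w) (hs : IsSigned n w) {a : ℤ}
    (ha : m ≤ a ∨ a ≤ -m) : m ≤ w a ∨ w a ≤ -m := by
  by_contra! h
  rcases lt_trichotomy (w a) 0 with h0 | h0 | h0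
  · have h1 := hw (-w a) (by omega) (by omega)
    rw [← hs.odd, w.injective.eq_iff] at h1
    have := hs.odd a
    omega
  · rw [← hs.map_zero, w.injective.eq_iff] at h0
    omega
  · have h1 := w.injective (hw (w a) (by omega) (by omega))
    omega

theorem FixesBelow.fstLetter_ge (hn : 2 ≤ n) (hi : 1 ≤ i ∧ i ≤ n)
    (h : FixesBelow m (simpleRefl n i)) : m ≤ fstLetter n i := by
  by_contra! h'
  have h1 := letters_spec hn hi
  have h2 := h _ h1.1 h'
  rw [simpleRefl_fst hn hi] at h2
  omega

theorem fixesBelow_simpleRefl (hn : 2 ≤ n) (hi : 1 ≤ i ∧ i ≤ n) (h : m ≤ fstLetter n i) :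
    FixesBelow m (simpleRefl n i) := by
  intro a h1 h2
  have := letters_spec hn hi
  have := simpleRefl_cases hn hi a
  omega

theorem fixesBelow_wordProd {L : List ℕ} (h : ∀ i ∈ L, FixesBelow m (simpleRefl n i)) :
    FixesBelow m (wordProd n L) := by
  induction L with
  | nil => exact fun _ _ _ => rfl
  | cons i L ih =>
    rw [wordProd_cons]
    exact (h i (by simp)).mul (ih fun j hj => h j (by simp [hj]))

/-- A reduced word of an element fixing `1, …, m - 1` consists of letters fixing them. -/
theorem IsMinWord.fixesBelow (hn : 2 ≤ n) {L : List ℕ} (hL : IsMinWord n L)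
    (hw : FixesBelow m (wordProd n L)) : ∀ i ∈ L, FixesBelow m (simpleRefl n i) := by
  induction L with
  | nil => simp
  | cons i A ih =>
    have hi := (isWord_cons.1 hL.1).1
    have hs : FixesBelow m (simpleRefl n i) := by
      refine fixesBelow_simpleRefl hn hi ?_
      by_contra! hlt
      have hd := hL.isDescent hn
      have hsw := isSigned_wordProd hn hL.1
      rw [IsDescent] at hd
      have h1 := letters_spec hn hi
      have hwi := hw.inv
      rw [hwi _ h1.1 hlt] at hd
      have h2 := letterHeight_cases n (fstLetter n i)
      have h3 := letterHeight_cases n ((wordProd n (i :: A))⁻¹ (sndLetter n i))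
      have hlet := hsw.inv.isLetter (isRootPair_letters hn hi).2.1
      unfold IsLetter at hlet
      have h4 := (wordProd n (i :: A))⁻¹.injective
        (hwi ((wordProd n (i :: A))⁻¹ (sndLetter n i)) (by omega) (by omega))
      omega
    intro j hj
    rcases List.mem_cons.1 hj with rfl | hj
    · exact hs
    · refine ih hL.tail ?_ j hj
      have := hs.mul hw
      rwa [wordProd_cons, simpleRefl_mul_cancel hn hi] at this

theorem IsMinWord.eq_or_height_lt (hn : 2 ≤ n) {L : List ℕ} (hL : IsMinWord n L) (hm : 1 ≤ m)
    (hmn : m ≤ n) (hfix : ∀ i ∈ L, FixesBelow m (simpleRefl n i)) {M : List ℕ}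
    (hM : List.Sublist M L) :
    wordProd n M m = wordProd n L m ∨
      letterHeight n (wordProd n L m) < letterHeight n (wordProd n M m) := by
  induction L generalizing M with
  | nil =>
    left
    rw [List.sublist_nil.1 hM]
  | cons i A ih =>
    have hi := (isWord_cons.1 hL.1).1
    have hA := isSigned_wordProd hn hL.tail.1
    have hfA : ∀ i ∈ A, FixesBelow m (simpleRefl n i) := fun j hj => hfix j (by simp [hj])
    have hfw := fixesBelow_wordProd hfA
    have hge := (hfix i (by simp)).fstLetter_ge hn hi
    have hr := isRootPair_letters hn hi
    have hsp := letters_spec hn hi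
    have hd := hL.not_isDescent_tail hn
    have hlm : IsLetter n m := ⟨by omega, by omega, hmn⟩
    have n1 : wordProd n A m ≠ sndLetter n i := by
      intro h
      rw [← h, show ∀ x, (wordProd n A)⁻¹ (wordProd n A x) = x from (wordProd n A).symm_apply_apply] at hd
      have h1 := hfw.inv.ge hA.inv (Or.inl hge)
      have h2 := letterHeight_cases n m
      have h3 := letterHeight_cases n ((wordProd n A)⁻¹ (fstLetter n i))
      have h4 := hA.inv.isLetter hr.1
      unfold IsLetter at h4
      omega
    have n2 : wordProd n A m ≠ -fstLetter n i := by
      intro h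
      have h0 : fstLetter n i = wordProd n A (-m) := by rw [hA.odd, h, neg_neg]
      rw [h0, show ∀ x, (wordProd n A)⁻¹ (wordProd n A x) = x from (wordProd n A).symm_apply_apply] at hd
      have h1 := hfw.inv.ge hA.inv (a := sndLetter n i) (by omega)
      have h2 := letterHeight_cases n (-m)
      have h3 := letterHeight_cases n ((wordProd n A)⁻¹ (sndLetter n i))
      have h4 := hA.inv.isLetter hr.2.1
      unfold IsLetter at h4
      omega
    have hAm := hA.isLetter hlm
    have hc := simpleRefl_cases hn hi (wordProd n A m)
    have e1 := letterHeight_cases n (wordProd n A m)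
    have e2 := letterHeight_cases n (simpleRefl n i (wordProd n A m))
    unfold IsLetter at hAm
    rw [wordProd_cons, Equiv.Perm.mul_apply]
    have key : ∀ M : List ℕ, List.Sublist M A → IsLetter n (wordProd n M m) := fun M hM =>
      (isSigned_wordProd hn fun j hj => hL.tail.1 j (hM.subset hj)).isLetter hlm
    cases hM with
    | cons _ hM =>
      have ih' := ih hL.tail hfA hM
      have hl := key _ hM
      unfold IsLetter at hl
      have e3 := letterHeight_cases n (wordProd n M m)
      generalize wordProd n M m = x at *
      generalize wordProd n A m = y at *
      generalize simpleRefl n i y = z at *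
      clear ih key hfA hfix hfw hd
      rcases hc with hc | hc | hc | hc | hc <;> omega
    | cons_cons _ hM =>
      rename_i M
      have ih' := ih hL.tail hfA hM
      have hl := key _ hM
      unfold IsLetter at hl
      rw [wordProd_cons, Equiv.Perm.mul_apply]
      rcases ih' with ih' | ih'
      · rw [ih']
        exact Or.inl rfl
      have e3 := letterHeight_cases n (wordProd n M m)
      have hc' := simpleRefl_cases hn hi (wordProd n M m)
      have e4 := letterHeight_cases n (simpleRefl n i (wordProd n M m))
      generalize wordProd n M m = x at *
      generalize wordProd n A m = y at *
      generalize simpleRefl n i y = z at *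
      generalize simpleRefl n i x = u at *
      clear ih key hfA hfix hfw hd
      rcases hc with hc | hc | hc | hc | hc <;> rcases hc' with hc' | hc' | hc' | hc' | hc' <;> omega

theorem IsMinWord.fixesBelow_of_wordCoeff_ne_zero (hn : 2 ≤ n) {L : List ℕ}
    (hL : IsMinWord n L) (hw : FixesBelow m (wordProd n L)) (h : wordCoeff n L v ≠ 0) :
    FixesBelow m v := by
  obtain ⟨M, hM, rfl⟩ := exists_sublist_of_wordCoeff_ne_zero hn hL.1 h
  exact fixesBelow_wordProd fun j hj => hL.fixesBelow hn hw j (hM.subset hj)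

theorem IsMinWord.eq_or_height_lt_of_wordCoeff_ne_zero (hn : 2 ≤ n) {L : List ℕ}
    (hL : IsMinWord n L) (hm : 1 ≤ m) (hmn : m ≤ n) (hw : FixesBelow m (wordProd n L))
    (h : wordCoeff n L v ≠ 0) :
    v m = wordProd n L m ∨ letterHeight n (wordProd n L m) < letterHeight n (v m) := by
  obtain ⟨M, hM, rfl⟩ := exists_sublist_of_wordCoeff_ne_zero hn hL.1 h
  exact hL.eq_or_height_lt hn hm hmn (hL.fixesBelow hn hw) hM

theorem IsMinWord.inv_eq_or_height_lt_of_wordCoeff_ne_zero (hn : 2 ≤ n) {L : List ℕ}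
    (hL : IsMinWord n L) (hm : 1 ≤ m) (hmn : m ≤ n) (hw : FixesBelow m (wordProd n L))
    (h : wordCoeff n L v ≠ 0) :
    v⁻¹ m = (wordProd n L)⁻¹ m ∨
      letterHeight n ((wordProd n L)⁻¹ m) < letterHeight n (v⁻¹ m) := by
  obtain ⟨M, hM, rfl⟩ := exists_sublist_of_wordCoeff_ne_zero hn hL.1 h
  rw [← wordProd_reverse hn hL.1, ← wordProd_reverse hn fun j hj => hL.1 j (hM.subset hj)]
  refine (hL.reverse hn).eq_or_height_lt hn hm hmn (fun j hj => ?_) hM.reverse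
  exact hL.fixesBelow hn hw j (List.mem_reverse.1 hj)

end Level

section Regularity

variable {n i : ℕ} {a b : ℤ} {f g : KK n}

/-- The substitution `a ↦ b` on letters. -/
def substLetter (a b c : ℤ) : ℤ := if c = a then b else if c = -a then -b else c

/-- The substitution `ε_a ↦ ε_b` on polynomials. -/
noncomputable def substHom (n : ℕ) (a b : ℤ) :
    MvPolynomial (Fin n) ℂ →ₐ[ℂ] MvPolynomial (Fin n) ℂ :=
  aeval fun k : Fin n => epsPoly n (substLetter a b ((k : ℕ) + 1))

theorem substHom_epsPoly (ha : IsLetter n a) (c : ℤ) :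
    substHom n a b (epsPoly n c) = epsPoly n (substLetter a b c) := by
  obtain ⟨h0, h1, h2⟩ := ha
  rcases lt_or_ge (n : ℤ) |c| with h | h
  · have : substLetter a b c = c := by
      rw [lt_abs] at h
      unfold substLetter
      split_ifs <;> omega
    rw [this, epsPoly_eq_zero h, map_zero]
  rw [abs_le] at h
  rcases lt_trichotomy c 0 with hc | rfl | hc
  · have hX := epsPoly_succ (⟨(-c - 1).toNat, by omega⟩ : Fin n)
    rw [show (((-c - 1).toNat : ℕ) : ℤ) + 1 = -c by omega, epsPoly_neg, neg_eq_iff_eq_neg] at hX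
    rw [hX, map_neg, substHom, aeval_X, ← epsPoly_neg]
    congr 1
    unfold substLetter
    dsimp only
    split_ifs <;> omega
  · have : substLetter a b 0 = 0 := by
      unfold substLetter
      split_ifs <;> omega
    rw [this]
    simp [epsPoly]
  · have hX := epsPoly_succ (⟨(c - 1).toNat, by omega⟩ : Fin n)
    rw [show (((c - 1).toNat : ℕ) : ℤ) + 1 = c by omega] at hX
    rw [hX, substHom, aeval_X]
    congr 2
    dsimp only
    omega

theorem substHom_rootPoly (ha : IsLetter n a) (c d : ℤ) :
    substHom n a b (rootPoly n c d) = rootPoly n (substLetter a b c) (substLetter a b d) := by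
  rw [rootPoly, map_sub, substHom_epsPoly ha, substHom_epsPoly ha, rootPoly]

theorem substHom_comp_swap (h : IsRootPair n a b) (p : MvPolynomial (Fin n) ℂ) :
    substHom n b a (substHom n a b p) = substHom n b a p := by
  change ((substHom n b a).comp (substHom n a b)) p = _
  congr 1
  ext1 k
  have hb := h.2.1
  rw [AlgHom.comp_apply, ← epsPoly_succ, substHom_epsPoly h.1, substHom_epsPoly hb,
    substHom_epsPoly hb]
  congr 1
  obtain ⟨h1, h2, h3, h4⟩ := h
  unfold IsLetter at *
  unfold substLetter
  split_ifs <;> omega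

theorem substHom_neg_neg : substHom n (-a) (-b) = substHom n a b := by
  unfold substHom
  congr 1
  funext k
  congr 1
  unfold substLetter
  split_ifs <;> omega

theorem substHom_polyAct {w : Equiv.Perm ℤ} (hw : IsSigned n w) (ha : IsLetter n a)
    (p : MvPolynomial (Fin n) ℂ) :
    substHom n (w a) (w b) (polyAct n w p) = polyAct n w (substHom n a b p) := by
  refine AlgHom.congr_fun (φ₁ := (substHom n (w a) (w b)).comp (polyAct n w))
    (φ₂ := (polyAct n w).comp (substHom n a b)) ?_ p
  ext1 k
  rw [AlgHom.comp_apply, AlgHom.comp_apply, ← epsPoly_succ, polyAct_epsPoly hw,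
    substHom_epsPoly ha, substHom_epsPoly (hw.isLetter ha), polyAct_epsPoly hw]
  congr 1
  unfold substLetter
  simp only [← hw.odd, w.injective.eq_iff]
  split_ifs <;> rfl

/-- `f` has no pole along the hyperplane `ε_a = ε_b`. -/
def IsRegularAlong (n : ℕ) (a b : ℤ) (f : KK n) : Prop :=
  ∃ p q : MvPolynomial (Fin n) ℂ, substHom n a b q ≠ 0 ∧ f * algebraMap _ _ q = algebraMap _ _ p

namespace IsRegularAlong

theorem ofPolynomial (p : MvPolynomial (Fin n) ℂ) :
    IsRegularAlong n a b (algebraMap _ (KK n) p) :=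
  ⟨p, 1, by simp, by simp⟩

theorem rootElem (c d : ℤ) : IsRegularAlong n a b (rootElem n c d) := IsRegularAlong.ofPolynomial _

theorem zero : IsRegularAlong n a b (0 : KK n) := by
  simpa using IsRegularAlong.ofPolynomial (n := n) (a := a) (b := b) 0

theorem one : IsRegularAlong n a b (1 : KK n) := by
  simpa using IsRegularAlong.ofPolynomial (n := n) (a := a) (b := b) 1

theorem add (hf : IsRegularAlong n a b f) (hg : IsRegularAlong n a b g) :
    IsRegularAlong n a b (f + g) := by
  obtain ⟨p, q, hq, h⟩ := hf
  obtain ⟨p', q', hq', h'⟩ := hg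
  refine ⟨p * q' + p' * q, q * q', by rw [map_mul]; exact mul_ne_zero hq hq', ?_⟩
  simp only [map_add, map_mul, ← h, ← h']
  ring

theorem mul (hf : IsRegularAlong n a b f) (hg : IsRegularAlong n a b g) :
    IsRegularAlong n a b (f * g) := by
  obtain ⟨p, q, hq, h⟩ := hf
  obtain ⟨p', q', hq', h'⟩ := hg
  refine ⟨p * p', q * q', by rw [map_mul]; exact mul_ne_zero hq hq', ?_⟩
  simp only [map_mul, ← h, ← h']
  ring

theorem neg (hf : IsRegularAlong n a b f) : IsRegularAlong n a b (-f) := by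
  obtain ⟨p, q, hq, h⟩ := hf
  exact ⟨-p, q, hq, by rw [map_neg, ← h, neg_mul]⟩

theorem sub (hf : IsRegularAlong n a b f) (hg : IsRegularAlong n a b g) :
    IsRegularAlong n a b (f - g) := by
  rw [sub_eq_add_neg]
  exact hf.add hg.neg

theorem inv_rootElem {c d : ℤ} (ha : IsLetter n a) (hb : IsLetter n b) (hcd : IsRootPair n c d)
    (h : substLetter a b c ≠ substLetter a b d) :
    IsRegularAlong n a b (_root_.rootElem n c d)⁻¹ := by
  refine ⟨1, rootPoly n c d, ?_, ?_⟩
  · rw [substHom_rootPoly ha]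
    obtain ⟨hc, hd, -⟩ := hcd
    unfold IsLetter at ha hb hc hd
    refine rootPoly_ne_zero_of_ne ?_ ?_ h <;> unfold IsLetter substLetter <;> split_ifs <;> omega
  · rw [map_one]
    exact inv_mul_cancel₀ (rootElem_ne_zero hcd)

theorem swap (h : IsRootPair n a b) (hf : IsRegularAlong n a b f) : IsRegularAlong n b a f := by
  obtain ⟨p, q, hq, hf⟩ := hf
  refine ⟨p, q, fun h0 => hq ?_, hf⟩
  rw [← substHom_comp_swap ⟨h.2.1, h.1, h.2.2.1.symm, by have := h.2.2.2; omega⟩, h0, map_zero]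

theorem neg_neg : IsRegularAlong n (-a) (-b) f ↔ IsRegularAlong n a b f := by
  rw [IsRegularAlong, substHom_neg_neg, IsRegularAlong]

theorem simpleAct (hn : 2 ≤ n) (hi : 1 ≤ i ∧ i ≤ n) (ha : IsLetter n a)
    (hf : IsRegularAlong n a b f) :
    IsRegularAlong n (simpleRefl n i a) (simpleRefl n i b) (simpleAct n i f) := by
  have hs := isSigned_simpleRefl hn hi
  obtain ⟨p, q, hq, h⟩ := hf
  refine ⟨polyAct n (simpleRefl n i) p, polyAct n (simpleRefl n i) q, ?_, ?_⟩
  · rw [substHom_polyAct hs ha]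
    exact fun h0 => hq (polyAct_injective hs (by rw [h0, map_zero]))
  · rw [← simpleAct_algebraMap hn hi, ← simpleAct_algebraMap hn hi, ← h, map_mul]

theorem of_simpleAct (hn : 2 ≤ n) (hi : 1 ≤ i ∧ i ≤ n) (ha : IsLetter n a)
    (hf : IsRegularAlong n a b (_root_.simpleAct n i f)) :
    IsRegularAlong n (simpleRefl n i a) (simpleRefl n i b) f := by
  have := hf.simpleAct hn hi ha
  rwa [simpleAct_simpleAct hn hi] at this

end IsRegularAlong

theorem rootPoly_dvd_sub_polyAct (hn : 2 ≤ n) (hi : 1 ≤ i ∧ i ≤ n) (p : MvPolynomial (Fin n) ℂ) :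
    rootPoly n (fstLetter n i) (sndLetter n i) ∣ p - polyAct n (simpleRefl n i) p := by
  induction p using MvPolynomial.induction_on with
  | C c =>
    rw [polyAct, ← algebraMap_eq, AlgHom.commutes, sub_self]
    exact dvd_zero _
  | add p q hp hq =>
    rw [map_add, add_sub_add_comm]
    exact dvd_add hp hq
  | mul_X p k hp =>
    have hX : rootPoly n (fstLetter n i) (sndLetter n i) ∣
        X k - polyAct n (simpleRefl n i) (X k) := by
      rw [← epsPoly_succ, polyAct_epsPoly (isSigned_simpleRefl hn hi)]
      rcases simpleRefl_cases hn hi ((k : ℕ) + 1) with ⟨h, h'⟩ | ⟨h, h'⟩ | ⟨h, h'⟩ | ⟨h, h'⟩ |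
        ⟨-, -, -, -, h'⟩ <;> rw [h']
      · exact ⟨1, by rw [h, rootPoly, mul_one]⟩
      · exact ⟨-1, by rw [h, rootPoly]; ring⟩
      · exact ⟨-1, by rw [h, rootPoly, epsPoly_neg, epsPoly_neg]; ring⟩
      · exact ⟨1, by rw [h, rootPoly, epsPoly_neg, epsPoly_neg]; ring⟩
      · rw [sub_self]
        exact dvd_zero _
    rw [map_mul, show p * X k - polyAct n (simpleRefl n i) p * polyAct n (simpleRefl n i) (X k) =
      (p - polyAct n (simpleRefl n i) p) * X k +
        polyAct n (simpleRefl n i) p * (X k - polyAct n (simpleRefl n i) (X k)) by ring]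
    exact dvd_add (hp.mul_right _) (hX.mul_left _)

theorem substHom_rootPoly_self (ha : IsLetter n a) (hb : IsRootPair n a b) :
    substHom n a b (rootPoly n a b) = 0 := by
  have h : substLetter a b b = b := by
    have := hb.2.2
    unfold substLetter
    split_ifs <;> omega
  rw [substHom_rootPoly ha, h, substLetter, if_pos rfl, rootPoly, sub_self]

/-- Divided differences preserve regularity along the corresponding simple root. -/
theorem IsRegularAlong.divDiff (hn : 2 ≤ n) (hi : 1 ≤ i ∧ i ≤ n)
    (hf : IsRegularAlong n (fstLetter n i) (sndLetter n i) f) :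
    IsRegularAlong n (fstLetter n i) (sndLetter n i)
      ((simpleElem n i)⁻¹ * (f - _root_.simpleAct n i f)) := by
  have hr := isRootPair_letters hn hi
  obtain ⟨p, q, hq, h⟩ := hf
  obtain ⟨x, hx⟩ := rootPoly_dvd_sub_polyAct hn hi p
  obtain ⟨y, hy⟩ := rootPoly_dvd_sub_polyAct hn hi q
  have h' := congrArg (_root_.simpleAct n i) h
  rw [map_mul, simpleAct_algebraMap hn hi, simpleAct_algebraMap hn hi] at h'
  have hα := simpleElem_ne_zero hn hi
  refine ⟨x * q - p * y, q * polyAct n (simpleRefl n i) q, ?_, ?_⟩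
  · rw [map_mul]
    refine mul_ne_zero hq ?_
    rw [← sub_sub_cancel q (polyAct n (simpleRefl n i) q), hy, map_sub, map_mul,
      substHom_rootPoly_self hr.1 hr, zero_mul, sub_zero]
    exact hq
  · rw [mul_assoc, inv_mul_eq_iff_eq_mul₀ hα]
    have e : rootPoly n (fstLetter n i) (sndLetter n i) * (x * q - p * y) =
        p * polyAct n (simpleRefl n i) q - polyAct n (simpleRefl n i) p * q := by
      linear_combination (-q) * hx + p * hy
    have e' := congrArg (algebraMap _ (KK n)) e
    rw [map_mul] at e'
    rw [simpleElem, _root_.rootElem, e', map_sub, map_mul, map_mul, map_mul, ← h, ← h']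
    ring

/-- Along any root hyperplane the coefficients of a word have at most simple poles, and the
coefficients at `v` and `t v` have opposite residues, where `t` is the corresponding reflection. -/
theorem isRegularAlong_wordCoeff (hn : 2 ≤ n) {L : List ℕ} (hL : IsWord n L) {a b : ℤ}
    (hab : IsRootPair n a b) (v : Equiv.Perm ℤ) :
    IsRegularAlong n a b (rootElem n a b * wordCoeff n L v) ∧
      IsRegularAlong n a b (wordCoeff n L v + wordCoeff n L (signedSwap a b * v)) := by
  induction L generalizing a b v with
  | nil =>
    have h : ∀ v, IsRegularAlong n a b (wordCoeff n [] v) := fun v => by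
      unfold wordCoeff
      split_ifs
      · exact IsRegularAlong.one
      · exact IsRegularAlong.zero
    exact ⟨(IsRegularAlong.rootElem _ _).mul (h v), (h v).add (h _)⟩
  | cons i L ih =>
    obtain ⟨hi, hL⟩ := isWord_cons.1 hL
    have hr := isRootPair_letters hn hi
    have hs := isSigned_simpleRefl hn hi
    have hα := simpleElem_ne_zero hn hi
    have hself : ∀ v, IsRegularAlong n (fstLetter n i) (sndLetter n i)
        (simpleElem n i * wordCoeff n (i :: L) v) ∧
        IsRegularAlong n (fstLetter n i) (sndLetter n i)
          (wordCoeff n (i :: L) v + wordCoeff n (i :: L) (simpleRefl n i * v)) := by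
      intro v
      have ih2 := (ih hL hr v).2
      rw [← simpleRefl_eq_signedSwap] at ih2
      have ih1 := (ih hL hr (simpleRefl n i * v)).1.divDiff hn hi
      rw [← simpleElem, map_mul, simpleAct_simpleElem_self hn hi] at ih1
      refine ⟨?_, ?_⟩
      · convert ih2.sub ih1 using 1
        rw [wordCoeff_cons, divDiff]
        field_simp
        ring
      · convert ih2.divDiff hn hi using 1
        rw [wordCoeff_cons, divDiff, divDiff, simpleRefl_mul_cancel hn hi, map_add]
        ring
    by_cases h1 : a = fstLetter n i ∧ b = sndLetter n i
    · obtain ⟨rfl, rfl⟩ := h1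
      rw [← simpleRefl_eq_signedSwap]
      exact hself v
    by_cases h2 : a = sndLetter n i ∧ b = fstLetter n i
    · obtain ⟨rfl, rfl⟩ := h2
      rw [signedSwap_comm, ← simpleRefl_eq_signedSwap, rootElem_swap, neg_mul]
      exact ⟨((hself v).1.swap hr).neg, (hself v).2.swap hr⟩
    by_cases h3 : a = -fstLetter n i ∧ b = -sndLetter n i
    · obtain ⟨rfl, rfl⟩ := h3
      rw [rootElem_neg_neg, signedSwap_neg _ _ hr.2.1.1 hr.1.1 hr.2.2.1.symm
        (by have := hr.2.2.2; omega), signedSwap_comm, ← simpleRefl_eq_signedSwap, rootElem_swap,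
        neg_mul, IsRegularAlong.neg_neg, IsRegularAlong.neg_neg]
      exact ⟨(hself v).1.neg, (hself v).2⟩
    by_cases h4 : a = -sndLetter n i ∧ b = -fstLetter n i
    · obtain ⟨rfl, rfl⟩ := h4
      rw [rootElem_neg_neg, signedSwap_neg _ _ hr.1.1 hr.2.1.1 hr.2.2.1 hr.2.2.2,
        ← simpleRefl_eq_signedSwap, IsRegularAlong.neg_neg,
        IsRegularAlong.neg_neg]
      exact ⟨(hself v).1.swap hr, (hself v).2.swap hr⟩
    have hinv : IsRegularAlong n a b (simpleElem n i)⁻¹ := by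
      refine IsRegularAlong.inv_rootElem hab.1 hab.2.1 hr ?_
      have := hr.2.2
      unfold substLetter
      split_ifs <;> omega
    have hab' := hs.isRootPair hab
    have e1 : simpleRefl n i * (signedSwap a b * v) =
        signedSwap (simpleRefl n i a) (simpleRefl n i b) * (simpleRefl n i * v) := by
      rw [← mul_assoc, hs.mul_signedSwap, mul_assoc]
    have key : ∀ {f : KK n}, IsRegularAlong n (simpleRefl n i a) (simpleRefl n i b) f →
        IsRegularAlong n a b (simpleAct n i f) := fun h => by
      have := h.simpleAct hn hi hab'.1
      rwa [simpleRefl_simpleRefl_apply hn hi, simpleRefl_simpleRefl_apply hn hi] at this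
    rw [wordCoeff_cons]
    simp only [divDiff]
    refine ⟨?_, ?_⟩
    · have := hinv.mul ((ih hL hab v).1.sub (key (ih hL hab' (simpleRefl n i * v)).1))
      rw [map_mul, simpleAct_rootElem hn hi, simpleRefl_simpleRefl_apply hn hi,
        simpleRefl_simpleRefl_apply hn hi] at this
      convert this using 1
      ring
    · have := hinv.mul ((ih hL hab v).2.sub (key (ih hL hab' (simpleRefl n i * v)).2))
      rw [← e1, map_add] at this
      convert this using 1
      ring

end Regularity

section Separation

variable {n i : ℕ} {a b m : ℤ} {f g : KK n}

/-- `f` is a fraction of polynomials invariant under the substitution `ε_a ↦ ε_b`. -/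
def IsSubstInvariant (n : ℕ) (a b : ℤ) (f : KK n) : Prop :=
  ∃ p q : MvPolynomial (Fin n) ℂ, substHom n a b p = p ∧ substHom n a b q = q ∧ q ≠ 0 ∧
    f * algebraMap _ _ q = algebraMap _ _ p

namespace IsSubstInvariant

theorem zero : IsSubstInvariant n a b (0 : KK n) := ⟨0, 1, by simp, by simp, by simp, by simp⟩

theorem one : IsSubstInvariant n a b (1 : KK n) := ⟨1, 1, by simp, by simp, by simp, by simp⟩

theorem mul (hf : IsSubstInvariant n a b f) (hg : IsSubstInvariant n a b g) :
    IsSubstInvariant n a b (f * g) := by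
  obtain ⟨p, q, hp, hq, h0, h⟩ := hf
  obtain ⟨p', q', hp', hq', h0', h'⟩ := hg
  refine ⟨p * p', q * q', by rw [map_mul, hp, hp'], by rw [map_mul, hq, hq'], mul_ne_zero h0 h0', ?_⟩
  simp only [map_mul, ← h, ← h']
  ring

theorem sub (hf : IsSubstInvariant n a b f) (hg : IsSubstInvariant n a b g) :
    IsSubstInvariant n a b (f - g) := by
  obtain ⟨p, q, hp, hq, h0, h⟩ := hf
  obtain ⟨p', q', hp', hq', h0', h'⟩ := hg
  refine ⟨p * q' - p' * q, q * q', ?_, by rw [map_mul, hq, hq'], mul_ne_zero h0 h0', ?_⟩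
  · simp only [map_sub, map_mul, hp, hp', hq, hq']
  simp only [map_mul, map_sub, ← h, ← h']
  ring

theorem inv_simpleElem (hn : 2 ≤ n) (hi : 1 ≤ i ∧ i ≤ n) (ha : IsLetter n a)
    (hia : simpleRefl n i a = a) : IsSubstInvariant n a b (simpleElem n i)⁻¹ := by
  have hr := isRootPair_letters hn hi
  have hc := simpleRefl_cases hn hi a
  refine ⟨1, rootPoly n (fstLetter n i) (sndLetter n i), map_one _, ?_, rootPoly_ne_zero hr, ?_⟩
  · have := hr.2.2
    have h1 : substLetter a b (fstLetter n i) = fstLetter n i := by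
      unfold substLetter
      split_ifs <;> omega
    have h2 : substLetter a b (sndLetter n i) = sndLetter n i := by
      unfold substLetter
      split_ifs <;> omega
    rw [substHom_rootPoly ha, h1, h2]
  · rw [map_one]
    exact inv_mul_cancel₀ (simpleElem_ne_zero hn hi)

theorem simpleAct (hn : 2 ≤ n) (hi : 1 ≤ i ∧ i ≤ n) (ha : IsLetter n a)
    (hia : simpleRefl n i a = a) (hib : simpleRefl n i b = b) (hf : IsSubstInvariant n a b f) :
    IsSubstInvariant n a b (simpleAct n i f) := by
  have hs := isSigned_simpleRefl hn hi
  have hc : ∀ p, substHom n a b (polyAct n (simpleRefl n i) p) =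
      polyAct n (simpleRefl n i) (substHom n a b p) := fun p => by
    have := substHom_polyAct (b := b) hs ha p
    rwa [hia, hib] at this
  obtain ⟨p, q, hp, hq, h0, h⟩ := hf
  refine ⟨polyAct n (simpleRefl n i) p, polyAct n (simpleRefl n i) q, by rw [hc, hp],
    by rw [hc, hq], fun h => h0 (polyAct_injective hs (by rw [h, map_zero])), ?_⟩
  rw [← simpleAct_algebraMap hn hi, ← simpleAct_algebraMap hn hi, ← h, map_mul]

theorem wordCoeff (hn : 2 ≤ n) (ha : IsLetter n a) {L : List ℕ} (hL : IsWord n L)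
    (h : ∀ i ∈ L, simpleRefl n i a = a ∧ simpleRefl n i b = b) (v : Equiv.Perm ℤ) :
    IsSubstInvariant n a b (wordCoeff n L v) := by
  induction L generalizing v with
  | nil =>
    unfold _root_.wordCoeff
    split_ifs
    · exact one
    · exact zero
  | cons i L ih =>
    obtain ⟨hi, hL⟩ := isWord_cons.1 hL
    have ih := ih hL fun j hj => h j (by simp [hj])
    obtain ⟨hia, hib⟩ := h i (by simp)
    exact (inv_simpleElem hn hi ha hia).mul ((ih v).sub ((ih _).simpleAct hn hi ha hia hib))

/-- An invariant fraction divided by `ε_a - ε_b` has a pole, unless it vanishes. -/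
theorem eq_zero (hab : IsRootPair n a b) (hf : IsSubstInvariant n a b f)
    (h : IsRegularAlong n a b ((rootElem n a b)⁻¹ * f)) : f = 0 := by
  obtain ⟨p, q, hp, hq, h0, h1⟩ := hf
  obtain ⟨p', q', hq', h2⟩ := h
  have hne := rootElem_ne_zero hab
  have e : algebraMap _ (KK n) (p * q') = algebraMap _ (KK n) (rootPoly n a b * p' * q) := by
    rw [map_mul, map_mul, map_mul, ← h1, ← h2, ← rootElem]
    field_simp
  have e' := congrArg (substHom n a b) (IsFractionRing.injective _ (KK n) e)
  rw [map_mul, map_mul, map_mul, substHom_rootPoly_self hab.1 hab, zero_mul, zero_mul, hp] at e'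
  have hp0 := (mul_eq_zero.1 e').resolve_right hq'
  rw [hp0, map_zero] at h1
  exact (mul_eq_zero.1 h1).resolve_right
    ((IsFractionRing.to_map_eq_zero_iff (K := KK n)).not.2 h0)

end IsSubstInvariant

end Separation

section Main

variable {n i : ℕ} {m b : ℤ} {L L' : List ℕ}

/-- Reduced words of basic involutions fixing `1, …, m - 1`. -/
structure IsLevelWord (n : ℕ) (m : ℤ) (L : List ℕ) : Prop where
  isMinWord : IsMinWord n L
  mul_self : wordProd n L * wordProd n L = 1
  basic : ∀ a, IsLetter n a → wordProd n L a ≠ -a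
  fixesBelow : FixesBelow m (wordProd n L)

/-- The coefficients at the identity separate the basic involutions fixing `1, …, m - 1`, and
do not vanish. -/
def IsSeparatedAt (n : ℕ) (m : ℤ) : Prop :=
  ∀ L L' : List ℕ, IsLevelWord n m L → IsLevelWord n m L' → ∀ a : KK n, a = 0 ∨ a = 1 →
    wordCoeff n L 1 = a * wordCoeff n L' 1 → wordProd n L = wordProd n L' ∧ a = 1

namespace IsLevelWord

theorem isSigned (hn : 2 ≤ n) (h : IsLevelWord n m L) : IsSigned n (wordProd n L) :=
  isSigned_wordProd hn h.isMinWord.1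

theorem inv (h : IsLevelWord n m L) : (wordProd n L)⁻¹ = wordProd n L :=
  inv_eq_of_mul_eq_one_left h.mul_self

theorem apply_apply (h : IsLevelWord n m L) (a : ℤ) : wordProd n L (wordProd n L a) = a := by
  rw [← Equiv.Perm.mul_apply, h.mul_self, Equiv.Perm.one_apply]

/-- The letters `±m` are the highest and the lowest among `±m, …, ±n`. -/
theorem height_bounds {a : ℤ} (hm : 1 ≤ m) (hmn : m < n) (ha : IsLetter n a)
    (h : m ≤ a ∨ a ≤ -m) :
    (a ≠ m → letterHeight n a < letterHeight n m) ∧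
      (a ≠ -m → letterHeight n (-m) < letterHeight n a) := by
  have h1 := letterHeight_cases n a
  have h2 := letterHeight_cases n m
  have h3 := letterHeight_cases n (-m)
  unfold IsLetter at ha
  omega

/-- If the word sends `m` to `b` and `ε_m - ε_b` is the simple root `αᵢ`, then the coefficient at
`sᵢ` comes from a word of a smaller involution. -/
theorem exists_of_letters (hn : 2 ≤ n) (hi : 1 ≤ i ∧ i ≤ n) (h : IsLevelWord n m L)
    (hp : fstLetter n i = m) (hb : wordProd n L m = sndLetter n i) :
    ∃ A, IsLevelWord n (m + 2) A ∧ wordProd n A = simpleRefl n i * wordProd n L ∧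
      wordCoeff n L (simpleRefl n i) =
        -((simpleElem n i)⁻¹ * simpleAct n i (wordCoeff n A 1)) := by
  have hs := h.isSigned hn
  have hr := isRootPair_letters hn hi
  have hsp := letters_spec hn hi
  have hb' : wordProd n L (sndLetter n i) = m := by rw [← hb, h.apply_apply]
  obtain ⟨A, hA, hAp, -⟩ := h.isMinWord.exists_cons hn hi (by
    have := height_letters hn hi
    rw [IsDescent, h.inv, hp, hb, hb', ← hp]
    omega)
  have hAe : wordProd n A = simpleRefl n i * wordProd n L := by
    rw [← hAp, wordProd_cons, simpleRefl_mul_cancel hn hi]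
  have hcomm : wordProd n L * simpleRefl n i = simpleRefl n i * wordProd n L := by
    nth_rw 1 [simpleRefl_eq_signedSwap n i]
    rw [hs.mul_signedSwap, hp, hb, hb', signedSwap_comm, ← hp, ← simpleRefl_eq_signedSwap]
  have hfix : FixesBelow (m + 2) (wordProd n A) := by
    have hsA := isSigned_wordProd hn hA.tail.1
    have e1 : wordProd n A m = m := by
      rw [hAe, Equiv.Perm.mul_apply, hb, simpleRefl_snd hn hi, hp]
    have e2 : wordProd n A (sndLetter n i) = sndLetter n i := by
      rw [hAe, Equiv.Perm.mul_apply, hb', ← hp, simpleRefl_fst hn hi]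
    have e3 := hsA.odd (sndLetter n i)
    have hm2 : FixesBelow m (wordProd n A) := by
      rw [hAe]
      exact (fixesBelow_simpleRefl hn hi hp.ge).mul h.fixesBelow
    have e4 : wordProd n A (m + 1) = m + 1 := by
      rcases hsp.2.2 with hq | ⟨hq, hq'⟩
      · rw [← hp, ← hq, e2]
      · rw [show m + 1 = -sndLetter n i by omega, e3, e2]
    have := (hm2.succ e1).succ e4
    rwa [add_assoc] at this
  refine ⟨A, ⟨hA.tail, ?_, ?_, hfix⟩, hAe, ?_⟩
  · rw [hAe, mul_assoc, ← mul_assoc (wordProd n L), hcomm, mul_assoc, h.mul_self, mul_one,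
      simpleRefl_mul_self hn hi]
  · intro a ha hc
    rw [hAe, Equiv.Perm.mul_apply] at hc
    have h1 := congrArg (simpleRefl n i) hc
    rw [simpleRefl_simpleRefl_apply hn hi, (isSigned_simpleRefl hn hi).odd] at h1
    have h2 := simpleRefl_cases hn hi a
    have hwp : wordProd n L (fstLetter n i) = sndLetter n i := by rw [hp, hb]
    have hwq : wordProd n L (sndLetter n i) = fstLetter n i := by rw [hb', hp]
    have h3 := hs.odd (fstLetter n i)
    have h4 := hs.odd (sndLetter n i)
    rw [hwp] at h3
    rw [hwq] at h4
    have h5 := h.basic a ha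
    have h6 := hr.2.2
    have h7 := hr.1.1
    have h8 := hr.2.1.1
    rcases h2 with ⟨h2, h2'⟩ | ⟨h2, h2'⟩ | ⟨h2, h2'⟩ | ⟨h2, h2'⟩ | ⟨-, -, -, -, h2'⟩
    · rw [h2', h2, hwp] at h1
      omega
    · rw [h2', h2, hwq] at h1
      omega
    · rw [h2', h2, h3] at h1
      omega
    · rw [h2', h2, h4] at h1
      omega
    · rw [h2'] at h1
      exact h5 h1
  · rw [h.isMinWord.wordCoeff_eq hn hA hAp.symm, wordCoeff_cons, divDiff,
      simpleRefl_mul_self hn hi]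
    have h0 : wordCoeff n A (simpleRefl n i) = 0 := by
      by_contra h0
      have := hA.tail.fixesBelow_of_wordCoeff_ne_zero hn hfix h0 m (by omega) (by omega)
      rw [← hp, simpleRefl_fst hn hi] at this
      exact hr.2.2.1 this.symm
    rw [h0, zero_sub, mul_neg]

/-- Conjugating by a simple reflection that fixes `m` and raises `b`. -/
theorem exists_conj (hn : 2 ≤ n) (hi : 1 ≤ i ∧ i ≤ n) (hm : 1 ≤ m) (h : IsLevelWord n m L)
    (hp : m < fstLetter n i) (hb : wordProd n L m = b)
    (hbi : b = sndLetter n i ∨ b = -fstLetter n i) :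
    ∃ B, IsLevelWord n m B ∧
      wordProd n B = simpleRefl n i * wordProd n L * simpleRefl n i ∧
      wordCoeff n L (signedSwap m b) = -((simpleElem n i)⁻¹ *
        ((rootElem n (signedSwap m b (fstLetter n i)) (signedSwap m b (sndLetter n i)))⁻¹ *
          simpleAct n i (wordCoeff n B (signedSwap m (simpleRefl n i b))))) := by
  have hs := h.isSigned hn
  have hr := isRootPair_letters hn hi
  have hsp := letters_spec hn hi
  have hsi := isSigned_simpleRefl hn hi
  have hfi := fixesBelow_simpleRefl hn hi hp.le
  have him : simpleRefl n i m = m := by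
    have := simpleRefl_cases hn hi m
    omega
  have hmn : m < n := by omega
  have hbm : wordProd n L b = m := by rw [← hb, h.apply_apply]
  -- heights of the images of the letters of `αᵢ`, before and after applying `sᵢ`
  have hdesc : ∀ u : Equiv.Perm ℤ, IsSigned n u → FixesBelow m u → u b = m →
      letterHeight n (u (fstLetter n i)) < letterHeight n (u (sndLetter n i)) := by
    intro u hu hfu hub
    rcases hbi with hbi | hbi
    · rw [← hbi, hub]
      refine (height_bounds hm hmn (hu.isLetter hr.1) (hfu.ge hu (Or.inl hp.le))).1 ?_
      rw [← hub, Ne, u.injective.eq_iff, hbi]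
      exact hr.2.2.1
    · have h1 : u (fstLetter n i) = -m := by
        rw [← hub, ← hu.odd, hbi, neg_neg]
      rw [h1]
      refine (height_bounds hm hmn (hu.isLetter hr.2.1) (hfu.ge hu (by omega))).2 ?_
      rw [← h1, Ne, u.injective.eq_iff]
      exact hr.2.2.1.symm
  obtain ⟨A, hA, hAp, -⟩ := h.isMinWord.exists_cons hn hi (by
    rw [IsDescent, h.inv]
    exact hdesc _ hs h.fixesBelow hbm)
  have hAe : wordProd n A = simpleRefl n i * wordProd n L := by
    rw [← hAp, wordProd_cons, simpleRefl_mul_cancel hn hi]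
  have hfA : FixesBelow m (wordProd n A) := by
    rw [hAe]
    exact hfi.mul h.fixesBelow
  obtain ⟨B, hB, hBp⟩ := hA.tail.exists_append_singleton hn hi (by
    rw [IsDescent, inv_inv]
    refine hdesc _ (isSigned_wordProd hn hA.tail.1) hfA ?_
    rw [hAe, Equiv.Perm.mul_apply, hbm, him])
  have hBe : wordProd n B = simpleRefl n i * wordProd n L * simpleRefl n i := by
    rw [← hAe, ← hBp, wordProd_append, wordProd_cons, wordProd_nil, mul_one, mul_assoc,
      simpleRefl_mul_self hn hi, mul_one]
  have hBmin := hB.of_append_singleton hn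
  have hfB : FixesBelow m (wordProd n B) := by
    rw [hBe]
    exact (hfi.mul h.fixesBelow).mul hfi
  have hBsq : wordProd n B * wordProd n B = 1 := by
    rw [hBe]
    simp only [mul_assoc, simpleRefl_mul_cancel hn hi]
    rw [← mul_assoc (wordProd n L), h.mul_self, one_mul, simpleRefl_mul_self hn hi]
  have hheight : letterHeight n b < letterHeight n (simpleRefl n i b) ∧ simpleRefl n i b ≠ b := by
    have h1 := height_letters hn hi
    rcases hbi with rfl | rfl
    · rw [simpleRefl_snd hn hi]
      exact ⟨by omega, hr.2.2.1⟩
    · rw [hsi.odd, simpleRefl_fst hn hi]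
      have h2 := letterHeight_cases n (-fstLetter n i)
      have h3 := letterHeight_cases n (-sndLetter n i)
      omega
  have hbl : IsLetter n b := hb ▸ hs.isLetter ⟨by omega, by omega, by omega⟩
  have ht : ∀ x, signedSwap m b x =
      if x = m then b else if x = b then m else if x = -m then -b else if x = -b then -m else x :=
    signedSwap_apply (by omega) hbl.1 (by omega) (by omega)
  have htm : signedSwap m b m = b := by rw [ht, if_pos rfl]
  refine ⟨B, ⟨hBmin, hBsq, ?_, hfB⟩, hBe, ?_⟩
  · intro a ha hc
    rw [hBe, Equiv.Perm.mul_apply, Equiv.Perm.mul_apply] at hc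
    have h1 := congrArg (simpleRefl n i) hc
    rw [simpleRefl_simpleRefl_apply hn hi, hsi.odd] at h1
    exact h.basic _ (hsi.isLetter ha) h1
  have z1 : wordCoeff n A (signedSwap m b) = 0 := by
    by_contra h0
    have := hA.tail.eq_or_height_lt_of_wordCoeff_ne_zero hn hm hmn.le hfA h0
    rw [htm, hAe, Equiv.Perm.mul_apply, hb] at this
    omega
  have z2 : wordCoeff n B (simpleRefl n i * signedSwap m b) = 0 := by
    by_contra h0
    have := hBmin.inv_eq_or_height_lt_of_wordCoeff_ne_zero hn hm hmn.le hfB h0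
    rw [inv_eq_of_mul_eq_one_left hBsq, hBe, mul_inv_rev, simpleRefl_inv hn hi,
      Equiv.Perm.mul_apply, Equiv.Perm.mul_apply, Equiv.Perm.mul_apply, him, hb,
      show (signedSwap m b)⁻¹ m = b by
        rw [Equiv.Perm.inv_eq_iff_eq, ht]
        split_ifs <;> omega] at this
    omega
  have ht' : simpleRefl n i * signedSwap m b * simpleRefl n i =
      signedSwap m (simpleRefl n i b) := by
    rw [hsi.mul_signedSwap, him, mul_assoc, simpleRefl_mul_self hn hi, mul_one]
  rw [h.isMinWord.wordCoeff_eq hn hA hAp.symm, wordCoeff_cons, divDiff, z1,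
    hA.tail.wordCoeff_eq hn hB hBp.symm, wordCoeff_append_singleton hn hi hBmin.1, z2, zero_add,
    ht', map_mul, map_inv₀, simpleAct_rootElem hn hi]
  simp only [Equiv.Perm.mul_apply, simpleRefl_simpleRefl_apply hn hi]
  ring

theorem mono {m' : ℤ} (h : IsLevelWord n m L) (hf : FixesBelow m' (wordProd n L)) :
    IsLevelWord n m' L := ⟨h.isMinWord, h.mul_self, h.basic, hf⟩

end IsLevelWord

end Main

section Key

variable {n : ℕ} {m b : ℤ} {L L' : List ℕ}

/-- Either `ε_m - ε_b` is simple, or some simple reflection fixing `m` raises `b`. -/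
theorem exists_letters (hm : 1 ≤ m) (hmn : m < n) (hb : IsLetter n b) (hmb : m < b ∨ b < -m) :
    ∃ i : ℕ, (1 ≤ i ∧ i ≤ n) ∧ ((fstLetter n i = m ∧ sndLetter n i = b) ∨
      (m < fstLetter n i ∧ (b = sndLetter n i ∨ b = -fstLetter n i))) := by
  obtain ⟨h0, h1, h2⟩ := hb
  rcases lt_or_ge 0 b with hpos | hneg
  · refine ⟨(b - 1).toNat, by omega, ?_⟩
    rw [fstLetter, sndLetter, if_pos (by omega), if_pos (by omega)]
    omega
  · refine ⟨(-b).toNat, by omega, ?_⟩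
    unfold fstLetter sndLetter
    split_ifs <;> omega

namespace IsLevelWord

/-- The key step: a combination of coefficients at `s_{ε_m - ε_b}` without a pole along
`ε_m - ε_b`, where both words send `m` to `b`, is a trivial one. -/
theorem eq_of_isRegularAlong (hn : 2 ≤ n) (hm : 1 ≤ m) (hmn : m < n)
    (hsep : IsSeparatedAt n (m + 2)) {c : KK n} (hc : c = 0 ∨ c = 1)
    (h : IsLevelWord n m L) (h' : IsLevelWord n m L') (hb : wordProd n L m = b)
    (hb' : wordProd n L' m = b) (hbm : b ≠ m)
    (hreg : IsRegularAlong n m b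
      (wordCoeff n L (signedSwap m b) - c * wordCoeff n L' (signedSwap m b))) :
    wordProd n L = wordProd n L' ∧ c = 1 := by
  have hml : IsLetter n m := ⟨by omega, by omega, hmn.le⟩
  induction hk : (letterHeight n m - letterHeight n b).toNat using Nat.strong_induction_on
    generalizing b L L' with
  | _ k ih =>
    have hbl : IsLetter n b := hb ▸ (h.isSigned hn).isLetter hml
    have hbm' : b ≠ -m := hb ▸ h.basic m hml
    have hge := h.fixesBelow.ge (h.isSigned hn) (a := m) (Or.inl le_rfl)
    rw [hb] at hge
    have hmb : IsRootPair n m b := ⟨hml, hbl, hbm.symm, by omega⟩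
    have hact : ∀ i, simpleAct n i c = c := fun i => by
      rcases hc with rfl | rfl
      · exact map_zero _
      · exact map_one _
    obtain ⟨i, hi, ⟨hp, hq⟩ | ⟨hp, hq⟩⟩ := exists_letters hm hmn hbl (by omega)
    · obtain ⟨A, hA, hAe, hAc⟩ := h.exists_of_letters hn hi hp (hb.trans hq.symm)
      obtain ⟨B, hB, hBe, hBc⟩ := h'.exists_of_letters hn hi hp (hb'.trans hq.symm)
      have hsp := letters_spec hn hi
      have ht : signedSwap m b = simpleRefl n i := by rw [simpleRefl_eq_signedSwap, hp, hq]
      rw [ht, hAc, hBc] at hreg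
      have hreg' : IsRegularAlong n m b (simpleAct n i
          ((simpleElem n i)⁻¹ * (wordCoeff n A 1 - c * wordCoeff n B 1))) := by
        convert hreg using 1
        rw [map_mul, map_inv₀, simpleAct_simpleElem_self hn hi, map_sub, map_mul, hact]
        have := simpleElem_ne_zero hn hi
        field_simp
        ring
      have hreg'' := hreg'.of_simpleAct hn hi hml
      rw [← hp, ← hq, simpleRefl_fst hn hi, simpleRefl_snd hn hi] at hreg''
      have hr := isRootPair_letters hn hi
      have hinv : ∀ M, IsLevelWord n (m + 2) M → IsSubstInvariant n (fstLetter n i)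
          (sndLetter n i) (wordCoeff n M 1) := fun M hM => by
        refine .wordCoeff hn hr.1 hM.isMinWord.1 (fun j hj => ?_) _
        have hj' := hM.isMinWord.1 j hj
        have hjm := (hM.isMinWord.fixesBelow hn hM.fixesBelow j hj).fstLetter_ge hn hj'
        have hjs := letters_spec hn hj'
        have h1 := simpleRefl_cases hn hj' (fstLetter n i)
        have h2 := simpleRefl_cases hn hj' (sndLetter n i)
        omega
      have hcinv : IsSubstInvariant n (fstLetter n i) (sndLetter n i) c := by
        rcases hc with rfl | rfl
        · exact .zero
        · exact .one
      have h0 := ((hinv A hA).sub (hcinv.mul (hinv B hB))).eq_zero hr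
        (hreg''.swap ⟨hr.2.1, hr.1, hr.2.2.1.symm, by have := hr.2.2.2; omega⟩)
      obtain ⟨he, hc1⟩ := hsep A B hA hB c hc (sub_eq_zero.1 h0)
      exact ⟨mul_left_cancel (hAe.symm.trans (he.trans hBe)), hc1⟩
    · obtain ⟨A, hA, hAe, hAc⟩ := h.exists_conj hn hi hm hp hb hq
      obtain ⟨B, hB, hBe, hBc⟩ := h'.exists_conj hn hi hm hp hb' hq
      have hr := isRootPair_letters hn hi
      have hsp := letters_spec hn hi
      have him : simpleRefl n i m = m := by
        have := simpleRefl_cases hn hi m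
        omega
      have hsi := isSigned_simpleRefl hn hi
      have hroot := rootElem_ne_zero ((IsSigned.signedSwap hmb).isRootPair hr)
      have hsimple := simpleElem_ne_zero hn hi
      have hreg' : IsRegularAlong n m b (simpleAct n i
          (wordCoeff n A (signedSwap m (simpleRefl n i b)) -
            c * wordCoeff n B (signedSwap m (simpleRefl n i b)))) := by
        convert (((IsRegularAlong.rootElem (fstLetter n i) (sndLetter n i)).mul
          ((IsRegularAlong.rootElem (signedSwap m b (fstLetter n i))
            (signedSwap m b (sndLetter n i))).mul hreg)).neg) using 1
        rw [hAc, hBc, map_sub, map_mul, hact]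
        change _ = -(simpleElem n i * _)
        field_simp
        ring
      have hreg'' := hreg'.of_simpleAct hn hi hml
      rw [him] at hreg''
      have hheight : letterHeight n b < letterHeight n (simpleRefl n i b) ∧
          letterHeight n (simpleRefl n i b) ≤ letterHeight n m ∧ simpleRefl n i b ≠ m := by
        have h1 := simpleRefl_cases hn hi b
        have h2 := letterHeight_cases n b
        have h3 := letterHeight_cases n (simpleRefl n i b)
        have h4 := letterHeight_cases n m
        omega
      have hval : ∀ M N : List ℕ, wordProd n M m = b →
          wordProd n N = simpleRefl n i * wordProd n M * simpleRefl n i →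
          wordProd n N m = simpleRefl n i b := fun M N hM hN => by
        rw [hN, Equiv.Perm.mul_apply, Equiv.Perm.mul_apply, him, hM]
      obtain ⟨he, hc1⟩ := ih _ (by omega) hA hB (hval L A hb hAe) (hval L' B hb' hBe) hheight.2.2
        hreg'' rfl
      rw [hAe, hBe] at he
      exact ⟨mul_left_cancel (mul_right_cancel he), hc1⟩

end IsLevelWord

end Key

section Separated

variable {n : ℕ} {m : ℤ} {L L' : List ℕ}

namespace IsLevelWord

theorem eq_nil (hn : 2 ≤ n) (h : IsLevelWord n m L) (hm : n < m) : L = [] := by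
  rcases L with _ | ⟨i, A⟩
  · rfl
  · have hi := (isWord_cons.1 h.isMinWord.1).1
    have h1 := (h.isMinWord.fixesBelow hn h.fixesBelow i (by simp)).fstLetter_ge hn hi
    have h2 := letters_spec hn hi
    omega

/-- Separation of the words that agree at `m`. -/
theorem eq_of_apply_eq (hn : 2 ≤ n) (hm : 1 ≤ m) (hmn : m ≤ n)
    (hsep : ∀ k, m < k → IsSeparatedAt n k) {c : KK n} (hc : c = 0 ∨ c = 1)
    (h : IsLevelWord n m L) (h' : IsLevelWord n m L')
    (he : wordProd n L m = wordProd n L' m)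
    (hcoeff : wordCoeff n L 1 = c * wordCoeff n L' 1) :
    wordProd n L = wordProd n L' ∧ c = 1 := by
  have hml : IsLetter n m := ⟨by omega, by omega, hmn⟩
  by_cases hbm : wordProd n L m = m
  · exact hsep (m + 1) (by omega) L L' (h.mono (h.fixesBelow.succ hbm))
      (h'.mono (h'.fixesBelow.succ (he ▸ hbm))) c hc hcoeff
  · have hbl := (h.isSigned hn).isLetter hml
    have hbm' := h.basic m hml
    have hge := h.fixesBelow.ge (h.isSigned hn) (a := m) (Or.inl le_rfl)
    have hmn' : m < n := by
      unfold IsLetter at hbl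
      omega
    have hmb : IsRootPair n m (wordProd n L m) := ⟨hml, hbl, Ne.symm hbm, by omega⟩
    refine h.eq_of_isRegularAlong hn hm hmn' (hsep _ (by omega)) hc h' rfl he.symm hbm ?_
    have h1 := (isRegularAlong_wordCoeff hn h.isMinWord.1 hmb 1).2
    have h2 := (isRegularAlong_wordCoeff hn h'.isMinWord.1 hmb 1).2
    rw [mul_one] at h1 h2
    have hcr : IsRegularAlong n m (wordProd n L m) c := by
      rcases hc with rfl | rfl
      · exact .zero
      · exact .one
    convert h1.sub (hcr.mul h2) using 1
    rw [hcoeff]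
    ring

theorem wordCoeff_one_ne_zero (hn : 2 ≤ n) (hm : 1 ≤ m) (hmn : m ≤ n)
    (hsep : ∀ k, m < k → IsSeparatedAt n k) (h : IsLevelWord n m L) : wordCoeff n L 1 ≠ 0 :=
  fun h0 => zero_ne_one (h.eq_of_apply_eq hn hm hmn hsep (Or.inl rfl) h rfl
    (by rw [h0, mul_zero])).2

/-- If the coefficients at the identity agree, then so do the images of `m`: otherwise only one of
them has a pole along `ε_m - ε_b`. -/
theorem apply_eq_or_height_lt (hn : 2 ≤ n) (hm : 1 ≤ m) (hmn : m ≤ n)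
    (hsep : ∀ k, m < k → IsSeparatedAt n k) (h : IsLevelWord n m L) (h' : IsLevelWord n m L')
    (hcoeff : wordCoeff n L 1 = wordCoeff n L' 1) :
    wordProd n L m = m ∨ wordProd n L m = wordProd n L' m ∨
      letterHeight n (wordProd n L' m) < letterHeight n (wordProd n L m) := by
  have hml : IsLetter n m := ⟨by omega, by omega, hmn⟩
  by_contra! hcon
  obtain ⟨hbm, hne, hle⟩ := hcon
  have hbl := (h.isSigned hn).isLetter hml
  have hbm' := h.basic m hml
  have hge := h.fixesBelow.ge (h.isSigned hn) (a := m) (Or.inl le_rfl)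
  have hmn' : m < n := by
    unfold IsLetter at hbl
    omega
  have hmb : IsRootPair n m (wordProd n L m) := ⟨hml, hbl, Ne.symm hbm, by omega⟩
  have htm : signedSwap m (wordProd n L m) m = wordProd n L m := by
    rw [signedSwap_apply hml.1 hbl.1 hmb.2.2.1 hmb.2.2.2, if_pos rfl]
  have h0 : wordCoeff n L' (signedSwap m (wordProd n L m)) = 0 := by
    by_contra h0
    have := h'.isMinWord.eq_or_height_lt_of_wordCoeff_ne_zero hn hm hmn h'.fixesBelow h0
    rw [htm] at this
    omega
  have h1 := (isRegularAlong_wordCoeff hn h.isMinWord.1 hmb 1).2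
  have h2 := (isRegularAlong_wordCoeff hn h'.isMinWord.1 hmb 1).2
  rw [mul_one] at h1 h2
  rw [h0, add_zero, ← hcoeff] at h2
  refine zero_ne_one (α := KK n) (h.eq_of_isRegularAlong hn hm hmn' (hsep _ (by omega)) (Or.inl rfl)
    h rfl rfl hbm ?_).2
  convert h1.sub h2 using 1
  ring

end IsLevelWord

theorem isSeparatedAt (hn : 2 ≤ n) (hm : 1 ≤ m) : IsSeparatedAt n m := by
  induction hk : (n + 1 - m).toNat using Nat.strong_induction_on generalizing m with
  | _ k ih =>
    intro L L' h h' c hc hcoeff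
    rcases lt_or_ge (n : ℤ) m with hmn | hmn
    · rw [h.eq_nil hn hmn, h'.eq_nil hn hmn] at hcoeff ⊢
      refine ⟨rfl, ?_⟩
      simpa [wordCoeff] using hcoeff.symm
    · have hsep : ∀ k, m < k → IsSeparatedAt n k := fun k hk => ih _ (by omega) (by omega) rfl
      refine h.eq_of_apply_eq hn hm hmn hsep hc h' ?_ hcoeff
      rcases hc with rfl | rfl
      · rw [zero_mul] at hcoeff
        exact absurd hcoeff (h.wordCoeff_one_ne_zero hn hm hmn hsep)
      rw [one_mul] at hcoeff
      have h1 := h.apply_eq_or_height_lt hn hm hmn hsep h' hcoeff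
      have h2 := h'.apply_eq_or_height_lt hn hm hmn hsep h hcoeff.symm
      have hml : IsLetter n m := ⟨by omega, by omega, hmn⟩
      have g1 := h.fixesBelow.ge (h.isSigned hn) (a := m) (Or.inl le_rfl)
      have g2 := h'.fixesBelow.ge (h'.isSigned hn) (a := m) (Or.inl le_rfl)
      have l1 := (h.isSigned hn).isLetter hml
      have l2 := (h'.isSigned hn).isLetter hml
      have e0 := letterHeight_cases n m
      have e1 := letterHeight_cases n (wordProd n L m)
      have e2 := letterHeight_cases n (wordProd n L' m)
      unfold IsLetter at l1 l2
      omega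

theorem IsBasicInvolution.isLevelWord {w : Equiv.Perm ℤ} (h : IsBasicInvolution n w)
    (hL : IsReducedWord n w L) : IsLevelWord n 1 L := by
  obtain ⟨⟨hodd, -⟩, hsq, hb⟩ := h
  have hw := hL.2.1
  refine ⟨hL.isMinWord, by rw [hw, hsq], fun a ha e => ?_, fun a h1 h2 => by omega⟩
  rw [hw] at e
  obtain ⟨h0, h1, h2⟩ := ha
  rcases lt_or_ge 0 a with hpos | hneg
  · exact hb a hpos h2 e
  · exact hb (-a) (by omega) (by omega) (by rw [hodd, e])

end Separated

/-- Let `n ≥ 4` and let `σ ≠ τ` be basic involutions in the Weyl group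
of type `Dₙ`. Then their Kostant–Kumar polynomials differ: `d_σ ≠ d_τ` in
`ℂ(x₁, …, xₙ)`, for any choices of reduced decompositions of `σ` and `τ`. -/
theorem statement2 (n : ℕ) (hn : 4 ≤ n) (σ τ : Equiv.Perm ℤ)
    (hσ : IsBasicInvolution n σ) (hτ : IsBasicInvolution n τ) (hne : σ ≠ τ)
    (Lσ Lτ : List ℕ) (hLσ : IsReducedWord n σ Lσ) (hLτ : IsReducedWord n τ Lτ) :
    dElem n Lσ ≠ dElem n Lτ := by
  have hn2 : 2 ≤ n := by omega
  intro hd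
  rw [dElem_eq hn2 hLσ.1, dElem_eq hn2 hLτ.1] at hd
  have hpos := (IsFractionRing.to_map_eq_zero_iff (K := KK n)).not.2 (prodPosRoots_ne_zero n)
  have he := (isSeparatedAt hn2 le_rfl Lσ Lτ (hσ.isLevelWord hLσ) (hτ.isLevelWord hLτ) 1
    (Or.inr rfl) ((mul_right_cancel₀ hpos hd).trans (one_mul _).symm)).1
  exact hne (by rw [← hLσ.2.1, ← hLτ.2.1, he])
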